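/- arXiv:1307.6018 — 2 statements merged into one kernel-verified Lean document; each statement's English description precedes it below -/
import Mathlib

section
/- Convolution is majorized by convolution of rearrangements: if f_1,…,f_k are probability densities on R^n, then f_1 ⋆ ⋯ ⋆ f_k ≺ f_1* ⋆ ⋯ ⋆ f_k*, i.e., for every r > 0, ∫_{‖x‖<r} (f_1 ⋆ ⋯ ⋆ f_k)*(x) dx ≤ ∫_{‖x‖<r} (f_1* ⋆ ⋯ ⋆ f_k*)*(x) dx. -/
open MeasureTheory Set Filter ENNReal

noncomputable section

/-- The spherically symmetric (decreasing) rearrangement of a set `A ⊆ ℝⁿ`: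
the centered open ball with the same Lebesgue measure as `A`
(empty if `A` is null, all of `ℝⁿ` if `A` has infinite measure). -/
def ballRearrange (n : ℕ) (A : Set (EuclideanSpace ℝ (Fin n))) :
    Set (EuclideanSpace ℝ (Fin n)) :=
  {x | volume (Metric.ball (0 : EuclideanSpace ℝ (Fin n)) ‖x‖) < volume A}

/-- The spherically symmetric decreasing rearrangement of a function:
`f*(y) = ∫₀^∞ 1{y ∈ {x : f x > t}*} dt`. -/
def symmRearr (n : ℕ) (f : EuclideanSpace ℝ (Fin n) → ℝ≥0∞) :
    EuclideanSpace ℝ (Fin n) → ℝ≥0∞ :=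
  fun y => ∫⁻ t in Ioi (0 : ℝ), (ballRearrange n {x | ENNReal.ofReal t < f x}).indicator 1 y

/-- `f` is a probability density on `ℝⁿ`. -/
def IsDensity (n : ℕ) (f : EuclideanSpace ℝ (Fin n) → ℝ≥0∞) : Prop :=
  Measurable f ∧ ∫⁻ x, f x = 1

/-- Integral of the positive part of `-f log f`. -/
def entPos (n : ℕ) (f : EuclideanSpace ℝ (Fin n) → ℝ≥0∞) : ℝ≥0∞ :=
  ∫⁻ x, ENNReal.ofReal (-((f x).toReal * Real.log (f x).toReal))

/-- Integral of the negative part of `-f log f`. -/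
def entNeg (n : ℕ) (f : EuclideanSpace ℝ (Fin n) → ℝ≥0∞) : ℝ≥0∞ :=
  ∫⁻ x, ENNReal.ofReal ((f x).toReal * Real.log (f x).toReal)

/-- The Shannon differential entropy `h(f) = -∫ f log f` is well defined. -/
def EntDefined (n : ℕ) (f : EuclideanSpace ℝ (Fin n) → ℝ≥0∞) : Prop :=
  entPos n f ≠ ⊤ ∨ entNeg n f ≠ ⊤

/-- The Shannon differential entropy as an extended real number. -/
def entropy (n : ℕ) (f : EuclideanSpace ℝ (Fin n) → ℝ≥0∞) : EReal :=
  (entPos n f : EReal) - (entNeg n f : EReal)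

/-- The Rényi entropy of order `p ∈ (0,1) ∪ (1,∞)`:
`h_p(f) = (1/(1-p)) log ∫ f^p`. -/
def renyi (n : ℕ) (f : EuclideanSpace ℝ (Fin n) → ℝ≥0∞) (p : ℝ) : EReal :=
  (((1 - p)⁻¹ : ℝ) : EReal) * ENNReal.log (∫⁻ x, f x ^ p)

/-- Convolution of two `ℝ≥0∞`-valued functions on `ℝⁿ`. -/
def conv2 (n : ℕ) (f g : EuclideanSpace ℝ (Fin n) → ℝ≥0∞) :
    EuclideanSpace ℝ (Fin n) → ℝ≥0∞ :=
  fun x => ∫⁻ y, f y * g (x - y)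

/-- Iterated convolution of a (nonempty) list of functions. -/
def convList (n : ℕ) : List (EuclideanSpace ℝ (Fin n) → ℝ≥0∞) →
    (EuclideanSpace ℝ (Fin n) → ℝ≥0∞)
  | [] => fun _ => 0
  | [f] => f
  | f :: g :: rest => conv2 n f (convList n (g :: rest))

/-- `f ≺ g`: `f` is majorized by `g`. -/
def Majorizes (n : ℕ) (f g : EuclideanSpace ℝ (Fin n) → ℝ≥0∞) : Prop :=
  ∀ r : ℝ, 0 < r →
    ∫⁻ x in Metric.ball (0 : EuclideanSpace ℝ (Fin n)) r, symmRearr n f x ≤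
      ∫⁻ x in Metric.ball (0 : EuclideanSpace ℝ (Fin n)) r, symmRearr n g x

/-- The trilinear Riesz functional `∬ 1_C(x) 1_A(y) 1_B(x - y) dy dx` of three sets. -/
def rieszInt {V : Type*} [AddCommGroup V] [MeasureSpace V] (A B C : Set V) : ℝ≥0∞ :=
  ∫⁻ x, ∫⁻ y, C.indicator 1 x * (A.indicator 1 y * B.indicator 1 (x - y))

section RieszInt

variable {V : Type*} [AddCommGroup V] [MeasureSpace V]

theorem rieszInt_mono {A B C A' B' C' : Set V} (hA : A ⊆ A') (hB : B ⊆ B') (hC : C ⊆ C') :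
    rieszInt A B C ≤ rieszInt A' B' C' := by
  unfold rieszInt
  gcongr

theorem measurable_indicator_sub [MeasurableAdd₂ V] [MeasurableNeg V] {B : Set V}
    (hB : MeasurableSet B) :
    Measurable fun p : V × V => B.indicator (1 : V → ℝ≥0∞) (p.1 - p.2) :=
  (measurable_one.indicator hB).comp measurable_sub

/-- The fibre function `x ↦ |A ∩ (x - B)|`, whose integral over `C` is `rieszInt A B C`. -/
theorem rieszInt_eq_setLIntegral [MeasurableAdd₂ V] [MeasurableNeg V] {A B C : Set V}
    (hA : MeasurableSet A) (hB : MeasurableSet B) (hC : MeasurableSet C) :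
    rieszInt A B C = ∫⁻ x in C, volume (A ∩ {y | x - y ∈ B}) := by
  have hmA : Measurable (A.indicator (1 : V → ℝ≥0∞)) := measurable_one.indicator hA
  have hmB := measurable_indicator_sub hB
  rw [← lintegral_indicator hC]
  refine lintegral_congr fun x => ?_
  rw [lintegral_const_mul _ (by fun_prop)]
  have hS : MeasurableSet (A ∩ {y | x - y ∈ B}) :=
    hA.inter ((measurable_const.sub measurable_id) hB)
  by_cases h : x ∈ C
  · simp only [h, indicator_of_mem, Pi.one_apply, one_mul]
    rw [← lintegral_indicator_one hS]
    refine lintegral_congr fun y => ?_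
    by_cases h2 : y ∈ A <;> by_cases h3 : x - y ∈ B <;> simp [h2, h3, indicator]
  · simp [h]

variable [MeasurableAdd₂ V] [MeasurableNeg V] [SFinite (volume : Measure V)]
  [(volume : Measure V).IsAddLeftInvariant]

theorem lintegral_indicator_mul_indicator_sub {A B : Set V} (hA : MeasurableSet A)
    (hB : MeasurableSet B) :
    ∫⁻ x, ∫⁻ y, A.indicator (1 : V → ℝ≥0∞) y * B.indicator 1 (x - y) =
      volume A * volume B := by
  have hmA : Measurable (A.indicator (1 : V → ℝ≥0∞)) := measurable_one.indicator hA
  have hmB : Measurable (B.indicator (1 : V → ℝ≥0∞)) := measurable_one.indicator hB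
  have hmB' := measurable_indicator_sub hB
  rw [lintegral_lintegral_swap (by fun_prop)]
  have (y : V) : ∫⁻ x, A.indicator (1 : V → ℝ≥0∞) y * B.indicator 1 (x - y) =
      A.indicator 1 y * volume B := by
    rw [lintegral_const_mul _ (by fun_prop), lintegral_sub_right_eq_self,
      lintegral_indicator_one hB]
  simp_rw [this]
  rw [lintegral_mul_const _ hmA, lintegral_indicator_one hA]

theorem rieszInt_le_add {A B C A' B' C' : Set V} (hA : MeasurableSet A) (hB : MeasurableSet B)
    (hC : MeasurableSet C) (hA' : MeasurableSet A') (hB' : MeasurableSet B')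
    (hC' : MeasurableSet C') :
    rieszInt A B C ≤ rieszInt A' B' C' + volume (A \ A') * volume B +
      volume A * volume (B \ B') + volume (C \ C') * volume A := by
  have hmA : Measurable (A.indicator (1 : V → ℝ≥0∞)) := measurable_one.indicator hA
  have hmAA : Measurable ((A \ A').indicator (1 : V → ℝ≥0∞)) :=
    measurable_one.indicator (hA.diff hA')
  have hmCC : Measurable ((C \ C').indicator (1 : V → ℝ≥0∞)) :=
    measurable_one.indicator (hC.diff hC')
  have hmA' : Measurable (A'.indicator (1 : V → ℝ≥0∞)) := measurable_one.indicator hA'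
  have hmC' : Measurable (C'.indicator (1 : V → ℝ≥0∞)) := measurable_one.indicator hC'
  have hdA : MeasurableSet (A \ A') := hA.diff hA'
  have hdB : MeasurableSet (B \ B') := hB.diff hB'
  have hmB := measurable_indicator_sub hB
  have hmB' := measurable_indicator_sub hB'
  have hmBB := measurable_indicator_sub (hB.diff hB')
  have pt (x y : V) : C.indicator (1 : V → ℝ≥0∞) x * (A.indicator 1 y * B.indicator 1 (x - y)) ≤
      C'.indicator 1 x * (A'.indicator 1 y * B'.indicator 1 (x - y)) +
      (A \ A').indicator 1 y * B.indicator 1 (x - y) +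
      A.indicator 1 y * (B \ B').indicator 1 (x - y) +
      (C \ C').indicator 1 x * A.indicator 1 y := by
    by_cases h1 : x ∈ C <;> by_cases h2 : y ∈ A <;> by_cases h3 : x - y ∈ B <;>
    by_cases h1' : x ∈ C' <;> by_cases h2' : y ∈ A' <;> by_cases h3' : x - y ∈ B' <;>
    simp [h1, h2, h3, h1', h2', h3', indicator]
  calc rieszInt A B C
    _ ≤ ∫⁻ x, ∫⁻ y, (C'.indicator 1 x * (A'.indicator 1 y * B'.indicator 1 (x - y)) +
      (A \ A').indicator 1 y * B.indicator 1 (x - y) +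
      A.indicator 1 y * (B \ B').indicator 1 (x - y) +
      (C \ C').indicator 1 x * A.indicator 1 y) :=
        lintegral_mono fun x => lintegral_mono fun y => pt x y
    _ = _ := by
      have e (x : V) := lintegral_add_left (μ := volume) (f := fun y =>
        C'.indicator (1 : V → ℝ≥0∞) x * (A'.indicator 1 y * B'.indicator 1 (x - y)) +
        (A \ A').indicator 1 y * B.indicator 1 (x - y) +
        A.indicator 1 y * (B \ B').indicator 1 (x - y)) (by fun_prop)
        (fun y => (C \ C').indicator 1 x * A.indicator 1 y)
      have e2 (x : V) := lintegral_add_left (μ := volume) (f := fun y =>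
        C'.indicator (1 : V → ℝ≥0∞) x * (A'.indicator 1 y * B'.indicator 1 (x - y)) +
        (A \ A').indicator 1 y * B.indicator 1 (x - y)) (by fun_prop)
        (fun y => A.indicator 1 y * (B \ B').indicator 1 (x - y))
      have e3 (x : V) := lintegral_add_left (μ := volume) (f := fun y =>
        C'.indicator (1 : V → ℝ≥0∞) x * (A'.indicator 1 y * B'.indicator 1 (x - y))) (by fun_prop)
        (fun y => (A \ A').indicator 1 y * B.indicator 1 (x - y))
      have e4 (x : V) : ∫⁻ y, (C \ C').indicator (1 : V → ℝ≥0∞) x * A.indicator 1 y =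
          (C \ C').indicator 1 x * volume A := by
        rw [lintegral_const_mul _ hmA, lintegral_indicator_one hA]
      simp_rw [e, e2, e3, e4]
      have m1 : Measurable fun x => ∫⁻ y, C'.indicator (1 : V → ℝ≥0∞) x *
          (A'.indicator 1 y * B'.indicator 1 (x - y)) :=
        Measurable.lintegral_prod_right (by fun_prop)
      have m2 : Measurable fun x =>
          ∫⁻ y, (A \ A').indicator (1 : V → ℝ≥0∞) y * B.indicator 1 (x - y) :=
        Measurable.lintegral_prod_right (by fun_prop)
      have m3 : Measurable fun x =>
          ∫⁻ y, A.indicator (1 : V → ℝ≥0∞) y * (B \ B').indicator 1 (x - y) :=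
        Measurable.lintegral_prod_right (by fun_prop)
      rw [lintegral_add_left (by fun_prop), lintegral_add_left (by fun_prop), lintegral_add_left m1,
        lintegral_indicator_mul_indicator_sub (hA.diff hA') hB,
        lintegral_indicator_mul_indicator_sub hA (hB.diff hB'), lintegral_mul_const _ hmCC,
        lintegral_indicator_one (hC.diff hC')]
      rfl

end RieszInt

/-- The cumulative length `x ↦ |A ∩ (-∞, x]|` of a set `A ⊆ ℝ`. -/
def cumLength (A : Set ℝ) (x : ℝ) : ℝ := (volume (A ∩ Iic x)).toReal

theorem cumLength_mono {A : Set ℝ} (hA : volume A ≠ ∞) : Monotone (cumLength A) := fun x y h =>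
  ENNReal.toReal_mono (measure_ne_top_of_subset inter_subset_left hA) (by gcongr)

theorem cumLength_le_add {A : Set ℝ} (hA : volume A ≠ ∞) {x y : ℝ} (h : x ≤ y) :
    cumLength A y ≤ cumLength A x + (y - x) := by
  have h1 : volume (A ∩ Iic y) ≤ volume (A ∩ Iic x) + volume (Ioc x y) := by
    refine (measure_mono ?_).trans (measure_union_le _ _)
    rintro z ⟨hz, hzy⟩
    rcases le_or_gt z x with h | h
    · exact Or.inl ⟨hz, h⟩
    · exact Or.inr ⟨h, hzy⟩
  have fin := measure_ne_top_of_subset (μ := volume) (inter_subset_left (s := A) (t := Iic x)) hA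
  have := ENNReal.toReal_mono (by simp [fin]) h1
  rwa [ENNReal.toReal_add fin (by simp), Real.volume_Ioc, ENNReal.toReal_ofReal (by linarith)]
    at this

theorem lipschitzWith_cumLength {A : Set ℝ} (hA : volume A ≠ ∞) :
    LipschitzWith 1 (cumLength A) := by
  refine LipschitzWith.of_le_add fun x y => ?_
  rcases le_total x y with h | h
  · exact (cumLength_mono hA h).trans (by linarith [dist_nonneg (x := x) (y := y)])
  · rw [Real.dist_eq, abs_of_nonneg (by linarith)]
    exact cumLength_le_add hA h

theorem exists_mem_cumLength_eq {A : Set ℝ} (hA : IsCompact A) {s : ℝ} (hs : 0 < s)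
    (hs' : s < (volume A).toReal) : ∃ a ∈ A, cumLength A a = s := by
  have hfin := hA.measure_ne_top (μ := volume)
  obtain ⟨b, hb⟩ := hA.bddAbove
  obtain ⟨c, hc⟩ := hA.bddBelow
  have h0 : cumLength A (c - 1) = 0 := by
    have : A ∩ Iic (c - 1) = ∅ := by
      ext z
      simp only [mem_inter_iff, mem_Iic, mem_empty_iff_false, iff_false, not_and, not_le]
      intro hz
      linarith [hc hz]
    simp [cumLength, this]
  have h1 : cumLength A b = (volume A).toReal := by
    rw [cumLength, inter_eq_left.2 (show A ⊆ Iic b from fun z hz => hb hz)]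
  obtain ⟨x, hx⟩ : s ∈ range (cumLength A) :=
    mem_range_of_exists_le_of_exists_ge (lipschitzWith_cumLength hfin).continuous
      ⟨_, h0.trans_le hs.le⟩ ⟨_, hs'.le.trans h1.ge⟩
  have hK : IsCompact (A ∩ Iic x) := hA.inter_right isClosed_Iic
  have hne : (A ∩ Iic x).Nonempty := by
    rw [nonempty_iff_ne_empty]
    intro h
    simp [cumLength, h] at hx
    linarith
  obtain ⟨haA, hax⟩ := hK.sSup_mem hne
  refine ⟨_, haA, ?_⟩
  rw [← hx, cumLength, cumLength]
  congr 2
  ext z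
  refine and_congr_right fun hz => ⟨fun h => le_trans (mem_Iic.1 h) hax, fun h => ?_⟩
  exact le_csSup hK.bddAbove ⟨hz, h⟩

/-- The level function whose level sets in `A × B` are the hooks of the two sets. -/
def hookLevel (A B : Set ℝ) (a b : ℝ) : ℝ :=
  min (cumLength A a) ((volume B).toReal - cumLength B b)

theorem lipschitzWith_hookLevel {A B : Set ℝ} (hA : volume A ≠ ∞) (hB : volume B ≠ ∞) (x : ℝ) :
    LipschitzWith 1 fun a => hookLevel A B a (x - a) := by
  have h1 := lipschitzWith_cumLength hA
  have h2 : LipschitzWith 1 fun a => (volume B).toReal - cumLength B (x - a) := by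
    refine LipschitzWith.of_dist_le_mul fun y z => ?_
    have := (lipschitzWith_cumLength hB).dist_le_mul (x - y) (x - z)
    simpa only [dist_sub_left] using this
  have h3 := h1.min h2
  rw [max_self] at h3
  exact h3

theorem continuous_hookLevel {A B : Set ℝ} (hA : volume A ≠ ∞) (hB : volume B ≠ ∞) :
    Continuous fun p : ℝ × ℝ => hookLevel A B p.1 p.2 :=
  ((lipschitzWith_cumLength hA).continuous.comp continuous_fst).min
    (continuous_const.sub ((lipschitzWith_cumLength hB).continuous.comp continuous_snd))

theorem volume_image_le_of_lipschitzWith {f : ℝ → ℝ} (hf : LipschitzWith 1 f) (s : Set ℝ) :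
    volume (f '' s) ≤ volume s := by
  have := (hf.lipschitzOnWith (s := s)).hausdorffMeasure_image_le (d := 1) zero_le_one
  simpa [hausdorffMeasure_real] using this

theorem ofReal_le_volume_hook_sums {A B : Set ℝ} (hA : IsCompact A) (hB : IsCompact B) {s : ℝ}
    (hs : 0 < s) (hsA : s < (volume A).toReal) (hsB : s < (volume B).toReal) :
    ENNReal.ofReal ((volume A).toReal + (volume B).toReal - 2 * s) ≤
      volume {x | ∃ a ∈ A, ∃ b ∈ B, hookLevel A B a b = s ∧ a + b = x} := by
  have hfA := hA.measure_ne_top (μ := volume)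
  have hfB := hB.measure_ne_top (μ := volume)
  obtain ⟨a, haA, ha⟩ := exists_mem_cumLength_eq hA hs hsA
  obtain ⟨b, hbB, hb⟩ := exists_mem_cumLength_eq hB (s := (volume B).toReal - s)
    (by linarith) (by linarith)
  set P : Set ℝ := (fun x => a + x) '' (B ∩ Iic b)
  set Q : Set ℝ := (fun x => x + b) '' (A ∩ Ioi a)
  have hP : volume P = ENNReal.ofReal ((volume B).toReal - s) := by
    rw [← hb, cumLength, ENNReal.ofReal_toReal (measure_ne_top_of_subset inter_subset_left hfB)]
    simp only [P, image_add_left, measure_preimage_add]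
  have hQ : volume Q = ENNReal.ofReal ((volume A).toReal - s) := by
    have h1 : volume Q = volume (A ∩ Ioi a) := by
      simp only [Q, image_add_right, measure_preimage_add_right]
    have h2 : volume A = volume (A ∩ Iic a) + volume (A ∩ Ioi a) := by
      rw [← measure_inter_add_sdiff A (measurableSet_Iic (a := a))]
      congr 2
      ext; simp
    have f1 := measure_ne_top_of_subset (μ := volume) (inter_subset_left (s := A) (t := Iic a)) hfA
    have f2 := measure_ne_top_of_subset (μ := volume) (inter_subset_left (s := A) (t := Ioi a)) hfA
    rw [h1, ← ENNReal.ofReal_toReal f2]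
    congr 1
    rw [h2, ENNReal.toReal_add f1 f2, ← ha, cumLength]
    ring
  have hQm : MeasurableSet Q := by
    simp only [Q, image_add_right]
    exact (measurable_id.add_const _) (hA.measurableSet.inter measurableSet_Ioi)
  have hd : Disjoint P Q := by
    rw [Set.disjoint_left]
    rintro _ ⟨y, ⟨_, hy⟩, rfl⟩ ⟨z, ⟨_, hz⟩, h⟩
    simp only [mem_Iic, mem_Ioi] at *
    linarith
  calc _ = volume P + volume Q := by
        rw [hP, hQ, ← ENNReal.ofReal_add (by linarith) (by linarith)]
        congr 1; ring
    _ = volume (P ∪ Q) := (measure_union hd hQm).symm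
    _ ≤ _ := by
      refine measure_mono ?_
      rintro _ (⟨y, ⟨hy, hyb⟩, rfl⟩ | ⟨y, ⟨hy, hya⟩, rfl⟩)
      · refine ⟨a, haA, y, hy, ?_, rfl⟩
        have := cumLength_mono hfB hyb
        rw [hookLevel, ha, min_eq_left]
        linarith
      · refine ⟨y, hy, b, hbB, ?_, rfl⟩
        have := cumLength_mono hfA (le_of_lt hya)
        rw [hookLevel, hb, min_eq_right] <;> linarith

/-- The continuous analogue of Pollard's inequality on the line. -/
theorem ofReal_le_lintegral_min {A B : Set ℝ} (hA : IsCompact A) (hB : IsCompact B) {t : ℝ}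
    (ht : 0 ≤ t) (htA : t ≤ (volume A).toReal) (htB : t ≤ (volume B).toReal) :
    ENNReal.ofReal (t * ((volume A).toReal + (volume B).toReal - t)) ≤
      ∫⁻ x, min (volume (A ∩ {y | x - y ∈ B})) (ENNReal.ofReal t) := by
  have hfA := hA.measure_ne_top (μ := volume)
  have hfB := hB.measure_ne_top (μ := volume)
  set Z : Set (ℝ × ℝ) :=
    (fun p : ℝ × ℝ => (hookLevel A B p.1 p.2, p.1 + p.2)) '' (A ×ˢ B) ∩ (Ioo 0 t ×ˢ univ)
  have hZ : MeasurableSet Z := by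
    refine MeasurableSet.inter ?_ (measurableSet_Ioo.prod MeasurableSet.univ)
    exact ((hA.prod hB).image ((continuous_hookLevel hfA hfB).prodMk
      (continuous_fst.add continuous_snd))).measurableSet
  have h1 : ENNReal.ofReal (t * ((volume A).toReal + (volume B).toReal - t)) ≤ volume Z := by
    rw [Measure.volume_eq_prod, Measure.prod_apply hZ]
    calc ENNReal.ofReal (t * ((volume A).toReal + (volume B).toReal - t))
        = ∫⁻ s in Ioo 0 t, ENNReal.ofReal ((volume A).toReal + (volume B).toReal - 2 * s) := by
          rw [restrict_Ioo_eq_restrict_Ioc, ← ofReal_integral_eq_lintegral_ofReal]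
          · rw [← intervalIntegral.integral_of_le ht]
            congr 1
            rw [intervalIntegral.integral_sub (by simp) (by
              apply Continuous.intervalIntegrable; fun_prop),
              intervalIntegral.integral_const_mul, integral_id]
            simp
            ring
          · have : Continuous fun s : ℝ => (volume A).toReal + (volume B).toReal - 2 * s := by
              fun_prop
            exact this.integrableOn_Ioc
          · filter_upwards [ae_restrict_mem measurableSet_Ioc] with s hs
            simp only [Pi.zero_apply]
            linarith [hs.2]
      _ ≤ ∫⁻ s in Ioo 0 t, volume (Prod.mk s ⁻¹' Z) := by
          refine setLIntegral_mono' measurableSet_Ioo fun s hs => ?_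
          refine (ofReal_le_volume_hook_sums hA hB hs.1 (hs.2.trans_le htA)
            (hs.2.trans_le htB)).trans (measure_mono ?_)
          rintro x ⟨a, ha, b, hb, h, rfl⟩
          exact ⟨⟨(a, b), ⟨ha, hb⟩, by simp [h]⟩, hs, mem_univ _⟩
      _ ≤ _ := setLIntegral_le_lintegral _ _
  refine h1.trans ?_
  rw [Measure.volume_eq_prod, Measure.prod_apply_symm hZ]
  refine lintegral_mono fun x => le_min ?_ ?_
  · refine (measure_mono ?_).trans
      (volume_image_le_of_lipschitzWith (lipschitzWith_hookLevel hfA hfB x) _)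
    rintro s ⟨⟨⟨a, b⟩, ⟨ha, hb⟩, h⟩, -⟩
    simp only [Prod.mk.injEq] at h
    obtain ⟨h, rfl⟩ := h
    refine ⟨a, ⟨ha, ?_⟩, ?_⟩ <;> simpa
  · calc _ ≤ volume (Ioo 0 t) := measure_mono fun s hs => hs.2.1
      _ = _ := by simp

theorem rieszInt_univ {A B : Set ℝ} (hA : MeasurableSet A) (hB : MeasurableSet B) :
    rieszInt A B univ = volume A * volume B := by
  simp [rieszInt, lintegral_indicator_mul_indicator_sub hA hB]

theorem measurable_volume_inter_sub {A B : Set ℝ} (hA : MeasurableSet A) (hB : MeasurableSet B) :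
    Measurable fun x => volume (A ∩ {y | x - y ∈ B}) := by
  have : MeasurableSet {p : ℝ × ℝ | p.2 ∈ A ∧ p.1 - p.2 ∈ B} :=
    (measurable_snd hA).inter (measurable_sub hB)
  exact measurable_measure_prodMk_left this

theorem rieszInt_add_le {A B C : Set ℝ} (hA : IsCompact A) (hB : IsCompact B)
    (hC : MeasurableSet C) {t : ℝ} (ht : 0 ≤ t) (htA : t ≤ (volume A).toReal)
    (htB : t ≤ (volume B).toReal) :
    rieszInt A B C + ENNReal.ofReal (t * ((volume A).toReal + (volume B).toReal - t)) ≤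
      ENNReal.ofReal t * volume C + volume A * volume B := by
  have hmA := hA.measurableSet
  have hmB := hB.measurableSet
  have hf := measurable_volume_inter_sub hmA hmB
  set f : ℝ → ℝ≥0∞ := fun x => volume (A ∩ {y | x - y ∈ B})
  set T := ENNReal.ofReal t
  have e (x : ℝ) : f x = min (f x) T + (f x - T) := by
    rcases le_total (f x) T with h | h
    · rw [min_eq_left h, tsub_eq_zero_of_le h, add_zero]
    · rw [min_eq_right h, add_tsub_cancel_of_le h]
  have h1 : ∫⁻ x, f x = volume A * volume B := by
    rw [← rieszInt_univ hmA hmB, rieszInt_eq_setLIntegral hmA hmB MeasurableSet.univ]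
    simp [f]
  have h2 : ∫⁻ x, f x = (∫⁻ x, min (f x) T) + ∫⁻ x, (f x - T) := by
    rw [← lintegral_add_left (by fun_prop)]
    exact lintegral_congr e
  have h3 : rieszInt A B C ≤ T * volume C + ∫⁻ x, (f x - T) := by
    rw [rieszInt_eq_setLIntegral hmA hmB hC]
    calc ∫⁻ x in C, f x = ∫⁻ x in C, (min (f x) T + (f x - T)) := lintegral_congr e
      _ = (∫⁻ x in C, min (f x) T) + ∫⁻ x in C, (f x - T) := lintegral_add_left (by fun_prop) _
      _ ≤ _ := by
        gcongr
        · exact (lintegral_mono fun x => min_le_right _ _).trans (by simp)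
        · exact Measure.restrict_le_self
  calc _ ≤ T * volume C + (∫⁻ x, (f x - T)) + ∫⁻ x, min (f x) T := by
        gcongr
        exact ofReal_le_lintegral_min hA hB ht htA htB
    _ = _ := by rw [← h1, h2]; ring

theorem integral_min_sub_abs {L M γ : ℝ} (hLM : L ≤ M) (h1 : (M - L) / 2 ≤ γ) :
    ∫ x in -γ..γ, min L ((L + M) / 2 - |x|) = L * M - ((L + M) / 2 - γ) ^ 2 := by
  have hi (a b : ℝ) : IntervalIntegrable (fun x => min L ((L + M) / 2 - |x|)) volume a b := by
    apply Continuous.intervalIntegrable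
    fun_prop
  set δ := (M - L) / 2
  have hδ : 0 ≤ δ := by simp only [δ]; linarith
  have i2 : ∫ x in -δ..δ, min L ((L + M) / 2 - |x|) = ∫ x in -δ..δ, L := by
    refine intervalIntegral.integral_congr fun x hx => ?_
    rw [uIcc_of_le (by linarith)] at hx
    have := abs_le.2 hx
    exact min_eq_left (by simp only [δ] at this; linarith)
  have i3 : ∫ x in δ..γ, min L ((L + M) / 2 - |x|) = ∫ x in δ..γ, ((L + M) / 2 - x) := by
    refine intervalIntegral.integral_congr fun x hx => ?_
    rw [uIcc_of_le h1] at hx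
    have h := hx.1
    rw [abs_of_nonneg (hδ.trans h)]
    exact min_eq_right (by simp only [δ] at h; linarith)
  have i1 : ∫ x in -γ..-δ, min L ((L + M) / 2 - |x|) =
      ∫ x in δ..γ, min L ((L + M) / 2 - |x|) := by
    rw [← intervalIntegral.integral_comp_neg]
    simp
  rw [← intervalIntegral.integral_add_adjacent_intervals (hi (-γ) (-δ)) (hi (-δ) γ),
    ← intervalIntegral.integral_add_adjacent_intervals (hi (-δ) δ) (hi δ γ), i1, i2, i3,
    intervalIntegral.integral_sub (by simp) (by simp), integral_id]
  simp only [intervalIntegral.integral_const, smul_eq_mul, δ]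
  ring

theorem ofReal_le_volume_ball_inter_sub {m l : ℝ} (x : ℝ) :
    ENNReal.ofReal (min (min m l) ((m + l) / 2 - |x|)) ≤
      volume (Metric.ball (0 : ℝ) (m / 2) ∩ {y | x - y ∈ Metric.ball (0 : ℝ) (l / 2)}) := by
  calc _ ≤ ENNReal.ofReal (min (m / 2) (x + l / 2) - max (-(m / 2)) (x - l / 2)) := by
        refine ENNReal.ofReal_le_ofReal ?_
        have h0 := min_le_left (min m l) ((m + l) / 2 - |x|)
        have h3 := min_le_right (min m l) ((m + l) / 2 - |x|)
        have h1 := h0.trans (min_le_left m l)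
        have h2 := h0.trans (min_le_right m l)
        have h4 := le_abs_self x
        have h5 := neg_abs_le x
        rcases min_choice (m / 2) (x + l / 2) with h | h <;>
        rcases max_choice (-(m / 2)) (x - l / 2) with h' | h' <;> rw [h, h'] <;> linarith
    _ = volume (Ioo (max (-(m / 2)) (x - l / 2)) (min (m / 2) (x + l / 2))) := by
        rw [Real.volume_Ioo]
    _ ≤ _ := by
        refine measure_mono fun y hy => ?_
        simp only [mem_Ioo, max_lt_iff, lt_min_iff] at hy
        simp only [mem_inter_iff, mem_ball_zero_iff, Real.norm_eq_abs, abs_lt, mem_ofPred_eq]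
        refine ⟨⟨?_, ?_⟩, ?_, ?_⟩ <;> linarith [hy.1.1, hy.1.2, hy.2.1, hy.2.2]

theorem ofReal_le_rieszInt_ball {m l c : ℝ} (hm : 0 ≤ m) (hl : 0 ≤ l) (hc : 0 ≤ c) :
    ∃ t, 0 ≤ t ∧ t ≤ m ∧ t ≤ l ∧ ENNReal.ofReal (t * c + m * l) ≤
      rieszInt (Metric.ball (0 : ℝ) (m / 2)) (Metric.ball 0 (l / 2)) (Metric.ball 0 (c / 2)) +
        ENNReal.ofReal (t * (m + l - t)) := by
  have hL : 0 ≤ min m l := le_min hm hl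
  have hLM : min m l ≤ max m l := min_le_max
  have hsum : min m l + max m l = m + l := min_add_max m l
  have hprod : min m l * max m l = m * l := min_mul_max m l
  set L := min m l
  set M := max m l
  have key (γ : ℝ) (hγ : γ ≤ c / 2) : ∫⁻ x in Ioo (-γ) γ, ENNReal.ofReal
      (min L ((L + M) / 2 - |x|)) ≤ rieszInt (Metric.ball (0 : ℝ) (m / 2))
        (Metric.ball 0 (l / 2)) (Metric.ball 0 (c / 2)) := by
    rw [rieszInt_eq_setLIntegral Metric.isOpen_ball.measurableSet
      Metric.isOpen_ball.measurableSet Metric.isOpen_ball.measurableSet, hsum]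
    refine (lintegral_mono fun x => ofReal_le_volume_ball_inter_sub x).trans
      (lintegral_mono_set ?_)
    rw [Real.ball_eq_Ioo]
    exact Ioo_subset_Ioo (by linarith) (by linarith)
  have key2 (γ : ℝ) (h1 : (M - L) / 2 ≤ γ) (h2 : γ ≤ (L + M) / 2) :
      ENNReal.ofReal (L * M - ((L + M) / 2 - γ) ^ 2) =
        ∫⁻ x in Ioo (-γ) γ, ENNReal.ofReal (min L ((L + M) / 2 - |x|)) := by
    have hc : Continuous fun x : ℝ => min L ((L + M) / 2 - |x|) := by fun_prop
    rw [← integral_min_sub_abs hLM h1, intervalIntegral.integral_of_le (by linarith),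
      restrict_Ioo_eq_restrict_Ioc, ofReal_integral_eq_lintegral_ofReal hc.integrableOn_Ioc]
    filter_upwards [ae_restrict_mem measurableSet_Ioc] with x hx
    have := abs_le.2 ⟨hx.1.le, hx.2⟩
    exact le_min hL (show (0 : ℝ) ≤ _ by linarith)
  have key3 {x y : ℝ} {I : ℝ≥0∞} (z : ℝ) (hz : 0 ≤ z) (h : ENNReal.ofReal y ≤ I)
      (hy : x ≤ y + z) : ENNReal.ofReal x ≤ I + ENNReal.ofReal z := by
    calc _ ≤ ENNReal.ofReal (y + z) := ENNReal.ofReal_le_ofReal hy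
      _ ≤ _ := ENNReal.ofReal_add_le
      _ ≤ _ := by gcongr
  rcases le_total L ((L + M - c) / 2) with h | h
  · refine ⟨L, hL, min_le_left _ _, min_le_right _ _, ?_⟩
    refine key3 (y := L * c) _ (mul_nonneg hL (by linarith))
      ((le_of_eq ?_).trans (key (c / 2) le_rfl))
      (by rw [← hsum, ← hprod]; linarith)
    calc ENNReal.ofReal (L * c) = ∫⁻ x in Ioo (-(c / 2)) (c / 2), ENNReal.ofReal L := by
          rw [setLIntegral_const, Real.volume_Ioo, ENNReal.ofReal_mul hL]
          congr 2; ring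
      _ = _ := by
          refine setLIntegral_congr_fun measurableSet_Ioo fun x hx => ?_
          have := abs_lt.2 hx
          rw [min_eq_left]
          linarith
  rcases le_total 0 ((L + M - c) / 2) with h' | h'
  · refine ⟨(L + M - c) / 2, h', h.trans (min_le_left _ _), h.trans (min_le_right _ _), ?_⟩
    refine key3 _ (mul_nonneg h' (by linarith)) ((key2 (c / 2) (by linarith) (by linarith)).le.trans
      (key (c / 2) le_rfl)) (le_of_eq ?_)
    rw [← hsum, ← hprod]
    ring
  · refine ⟨0, le_rfl, hm, hl, ?_⟩
    refine key3 _ (by simp) ((key2 ((L + M) / 2) (by linarith) le_rfl).le.trans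
      (key _ (by linarith))) (le_of_eq ?_)
    rw [← hprod]
    ring

theorem rieszInt_le_rieszInt_ball_of_isCompact {A B C : Set ℝ} (hA : IsCompact A)
    (hB : IsCompact B) (hC : MeasurableSet C) (hfC : volume C ≠ ∞) :
    rieszInt A B C ≤ rieszInt (Metric.ball (0 : ℝ) ((volume A).toReal / 2))
      (Metric.ball 0 ((volume B).toReal / 2)) (Metric.ball 0 ((volume C).toReal / 2)) := by
  obtain ⟨t, ht, htA, htB, h⟩ := ofReal_le_rieszInt_ball (toReal_nonneg (a := volume A))
    (toReal_nonneg (a := volume B)) (toReal_nonneg (a := volume C))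
  have h2 := rieszInt_add_le hA hB hC ht htA htB
  rw [ENNReal.ofReal_add (by positivity) (by positivity), ENNReal.ofReal_mul ht,
    ENNReal.ofReal_mul toReal_nonneg, ofReal_toReal hfC, ofReal_toReal hA.measure_ne_top,
    ofReal_toReal hB.measure_ne_top] at h
  exact ENNReal.le_of_add_le_add_right ofReal_ne_top (h2.trans h)

/-- The Riesz–Sobolev inequality on the line. -/
theorem rieszInt_le_rieszInt_ball {A B C : Set ℝ} (hA : MeasurableSet A)
    (hB : MeasurableSet B) (hC : MeasurableSet C) (hfA : volume A ≠ ∞) (hfB : volume B ≠ ∞)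
    (hfC : volume C ≠ ∞) :
    rieszInt A B C ≤ rieszInt (Metric.ball (0 : ℝ) ((volume A).toReal / 2))
      (Metric.ball 0 ((volume B).toReal / 2)) (Metric.ball 0 ((volume C).toReal / 2)) := by
  set I := rieszInt (Metric.ball (0 : ℝ) ((volume A).toReal / 2))
      (Metric.ball 0 ((volume B).toReal / 2)) (Metric.ball 0 ((volume C).toReal / 2))
  have key (ε : ℝ≥0∞) (hε : ε ≠ 0) :
      rieszInt A B C ≤ I + (ε * volume B + volume A * ε) := by
    obtain ⟨K, hKA, hK, hKε⟩ := hA.exists_isCompact_sdiff_lt hfA hε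
    obtain ⟨K', hKB, hK', hKε'⟩ := hB.exists_isCompact_sdiff_lt hfB hε
    calc rieszInt A B C ≤ rieszInt K K' C + volume (A \ K) * volume B +
          volume A * volume (B \ K') + volume (C \ C) * volume A :=
          rieszInt_le_add hA hB hC hK.measurableSet hK'.measurableSet hC
      _ ≤ I + ε * volume B + volume A * ε + volume (C \ C) * volume A := by
          gcongr
          refine (rieszInt_le_rieszInt_ball_of_isCompact hK hK' hC hfC).trans ?_
          refine rieszInt_mono (Metric.ball_subset_ball ?_) (Metric.ball_subset_ball ?_) subset_rfl
          · have := ENNReal.toReal_mono hfA (measure_mono hKA)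
            linarith
          · have := ENNReal.toReal_mono hfB (measure_mono hKB)
            linarith
      _ = _ := by simp [add_assoc]
  have lim : Tendsto (fun ε : ℝ≥0∞ => I + (ε * volume B + volume A * ε)) (nhdsWithin 0 (Ioi 0))
      (nhds (I + (0 * volume B + volume A * 0))) := by
    refine (tendsto_const_nhds.add (Tendsto.add ?_ ?_)).mono_left nhdsWithin_le_nhds
    · exact ENNReal.Tendsto.mul_const tendsto_id (Or.inr hfB)
    · exact ENNReal.Tendsto.const_mul tendsto_id (Or.inr hfA)
  have := ge_of_tendsto lim (b := rieszInt A B C) (by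
    filter_upwards [self_mem_nhdsWithin] with ε hε using key ε (ne_of_gt hε))
  simpa using this

theorem rieszInt_preimage_add_right {V : Type*} [AddCommGroup V] [MeasureSpace V]
    [MeasurableAdd V] [(volume : Measure V).IsAddLeftInvariant] (A B C : Set V) (a b : V) :
    rieszInt ((· + a) ⁻¹' A) ((· + b) ⁻¹' B) ((· + (a + b)) ⁻¹' C) = rieszInt A B C := by
  have e (S : Set V) (a z : V) :
      ((· + a) ⁻¹' S).indicator (1 : V → ℝ≥0∞) z = S.indicator 1 (z + a) := rfl
  unfold rieszInt
  simp_rw [e]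
  conv_rhs => rw [← lintegral_add_right_eq_self (μ := volume) _ (a + b)]
  refine lintegral_congr fun x => ?_
  conv_rhs => rw [← lintegral_add_right_eq_self (μ := volume) _ a]
  refine lintegral_congr fun y => ?_
  rw [show x + (a + b) - (y + a) = x - y + b by abel]

section Steiner

variable {E : Type*} [NormedAddCommGroup E] [InnerProductSpace ℝ E]

/-- The length of the intersection of `A` with the line through `x` in direction `e`. -/
def lineLength (e : E) (A : Set E) (x : E) : ℝ≥0∞ := volume {s : ℝ | x + s • e ∈ A}

/-- The Steiner symmetrization of `A` in the direction of the unit vector `e`. -/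
def steiner (e : E) (A : Set E) : Set E :=
  {x | ENNReal.ofReal (2 * |inner ℝ x e|) < lineLength e A x}

theorem lineLength_add_smul (e : E) (A : Set E) (x : E) (t : ℝ) :
    lineLength e A (x + t • e) = lineLength e A x := by
  rw [lineLength, lineLength, ← measure_preimage_add volume t {s : ℝ | x + s • e ∈ A}]
  congr 1
  ext s
  simp [add_smul, add_assoc]

theorem steiner_mono (e : E) {A B : Set E} (h : A ⊆ B) : steiner e A ⊆ steiner e B :=
  fun x hx =>
  lt_of_lt_of_le (b := lineLength e A x) hx (measure_mono fun _ hs => h hs)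

theorem inner_add_smul_self {e : E} (he : ‖e‖ = 1) (x : E) (s : ℝ) :
    inner ℝ (x + s • e) e = s + inner ℝ x e := by
  rw [inner_add_left, real_inner_smul_left, real_inner_self_eq_norm_sq, he]
  ring

theorem setOf_add_smul_mem_steiner {e : E} (he : ‖e‖ = 1) {A : Set E} {x : E}
    (h : lineLength e A x ≠ ∞) :
    {s : ℝ | x + s • e ∈ steiner e A} =
      (· + inner ℝ x e) ⁻¹' Metric.ball 0 ((lineLength e A x).toReal / 2) := by
  ext s
  have : x + s • e ∈ steiner e A ↔
      ENNReal.ofReal (2 * |inner ℝ (x + s • e) e|) < lineLength e A (x + s • e) := Iff.rfl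
  rw [mem_ofPred_eq, this, lineLength_add_smul, inner_add_smul_self he,
    ENNReal.ofReal_lt_iff_lt_toReal (by positivity) h]
  simp only [mem_preimage, mem_ball_zero_iff, Real.norm_eq_abs]
  constructor <;> intro h <;> linarith

theorem lineLength_steiner {e : E} (he : ‖e‖ = 1) {A : Set E} {x : E}
    (h : lineLength e A x ≠ ∞) : lineLength e (steiner e A) x = lineLength e A x := by
  rw [lineLength, setOf_add_smul_mem_steiner he h, measure_preimage_add_right, Real.volume_ball,
    mul_div_cancel₀ _ two_ne_zero, ofReal_toReal h]

theorem setOf_add_smul_mem_ball {e : E} (he : ‖e‖ = 1) {R : ℝ} (hR : 0 ≤ R) (x : E) :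
    {s : ℝ | x + s • e ∈ Metric.ball 0 R} = (· + inner ℝ x e) ⁻¹'
      Metric.ball 0 (√(R ^ 2 - ‖x‖ ^ 2 + inner ℝ x e ^ 2)) := by
  ext s
  simp only [mem_ofPred_eq, mem_preimage, mem_ball_zero_iff, Real.norm_eq_abs]
  rw [Real.lt_sqrt (abs_nonneg _), sq_abs, ← sq_lt_sq₀ (norm_nonneg _) hR, norm_add_sq_real,
    norm_smul, he, real_inner_smul_right, mul_one, Real.norm_eq_abs, sq_abs]
  constructor <;> intro h <;> nlinarith

theorem lineLength_ball {e : E} (he : ‖e‖ = 1) {R : ℝ} (hR : 0 ≤ R) (x : E) :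
    lineLength e (Metric.ball 0 R) x =
      ENNReal.ofReal (2 * √(R ^ 2 - ‖x‖ ^ 2 + inner ℝ x e ^ 2)) := by
  rw [lineLength, setOf_add_smul_mem_ball he hR, measure_preimage_add_right, Real.volume_ball]

theorem steiner_ball {e : E} (he : ‖e‖ = 1) {R : ℝ} (hR : 0 ≤ R) :
    steiner e (Metric.ball 0 R) = Metric.ball 0 R := by
  ext x
  have : x ∈ steiner e (Metric.ball 0 R) ↔
      ENNReal.ofReal (2 * |inner ℝ x e|) < lineLength e (Metric.ball 0 R) x := Iff.rfl
  rw [this, lineLength_ball he hR, ENNReal.ofReal_lt_ofReal_iff_of_nonneg (by positivity),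
    mul_lt_mul_iff_right₀ two_pos, Real.lt_sqrt (abs_nonneg _), sq_abs, mem_ball_zero_iff,
    ← sq_lt_sq₀ (norm_nonneg _) hR]
  constructor <;> intro h <;> linarith

theorem lineLength_ne_top {e : E} (he : ‖e‖ = 1) {R : ℝ} (hR : 0 ≤ R) {A : Set E}
    (hA : A ⊆ Metric.ball 0 R) (x : E) : lineLength e A x ≠ ∞ :=
  ne_top_of_le_ne_top (b := lineLength e (Metric.ball 0 R) x)
    (by rw [lineLength_ball he hR]; exact ofReal_ne_top) (measure_mono fun _ hs => hA hs)

variable [MeasurableSpace E] [BorelSpace E] [FiniteDimensional ℝ E]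

theorem measurable_add_smul (e : E) : Measurable fun p : E × ℝ => p.1 + p.2 • e := by
  fun_prop

theorem measurable_lineLength (e : E) {A : Set E} (hA : MeasurableSet A) :
    Measurable (lineLength e A) :=
  measurable_measure_prodMk_left (measurable_add_smul e hA)

theorem measurableSet_steiner (e : E) {A : Set E} (hA : MeasurableSet A) :
    MeasurableSet (steiner e A) :=
  measurableSet_lt (by fun_prop) (measurable_lineLength e hA)

/-- The indicator of a slab of unit width orthogonal to `e`. -/
def slab (e : E) (x : E) : ℝ≥0∞ := (Ico (0 : ℝ) 1).indicator 1 (inner ℝ x e)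

theorem measurable_slab (e : E) : Measurable (slab e) :=
  (measurable_one.indicator measurableSet_Ico).comp (by fun_prop)

variable {μ : Measure E} [SFinite μ] [μ.IsAddLeftInvariant]

/-- Fubini's theorem along lines, with the quotient by the direction `e` replaced by a slab. -/
theorem lintegral_slab_mul {e : E} (he : ‖e‖ = 1) {φ : E → ℝ≥0∞} (hφ : Measurable φ) :
    ∫⁻ x, slab e x * (∫⁻ s : ℝ, φ (x + s • e)) ∂μ = ∫⁻ x, φ x ∂μ := by
  have hs := measurable_slab e
  have m1 : Measurable fun p : E × ℝ => φ (p.1 + p.2 • e) := hφ.comp (measurable_add_smul e)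
  have m2 : Measurable fun p : ℝ × E => slab e (p.2 - p.1 • e) * φ p.2 := by fun_prop
  calc ∫⁻ x, slab e x * (∫⁻ s : ℝ, φ (x + s • e)) ∂μ
      = ∫⁻ x, (∫⁻ s : ℝ, slab e x * φ (x + s • e)) ∂μ := by
        refine lintegral_congr fun x => ?_
        rw [lintegral_const_mul _ (by fun_prop)]
    _ = ∫⁻ s : ℝ, ∫⁻ x, slab e x * φ (x + s • e) ∂μ :=
        lintegral_lintegral_swap (by fun_prop)
    _ = ∫⁻ s : ℝ, ∫⁻ x, slab e (x - s • e) * φ x ∂μ := by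
        refine lintegral_congr fun s => ?_
        rw [← lintegral_add_right_eq_self (μ := μ) (fun x => slab e (x - s • e) * φ x) (s • e)]
        simp
    _ = ∫⁻ x, (∫⁻ s : ℝ, slab e (x - s • e)) * φ x ∂μ := by
        rw [lintegral_lintegral_swap (by fun_prop)]
        refine lintegral_congr fun x => ?_
        rw [lintegral_mul_const _ (by fun_prop)]
    _ = _ := by
        refine lintegral_congr fun x => ?_
        have : ∫⁻ s : ℝ, slab e (x - s • e) = 1 := by
          have h (s : ℝ) : slab e (x - s • e) =
              (Ico (0 : ℝ) 1).indicator 1 (inner ℝ x e - s) := by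
            rw [slab, sub_eq_add_neg, ← neg_smul, inner_add_smul_self he]
            congr 1; ring
          simp_rw [h]
          rw [lintegral_sub_left_eq_self, lintegral_indicator_one measurableSet_Ico]
          simp
        rw [this, one_mul]

theorem lintegral_slab_mul_lineLength {e : E} (he : ‖e‖ = 1) {A : Set E} (hA : MeasurableSet A) :
    ∫⁻ x, slab e x * lineLength e A x ∂μ = μ A := by
  rw [← lintegral_indicator_one hA, ← lintegral_slab_mul he (measurable_one.indicator hA)]
  refine lintegral_congr fun x => ?_
  congr 1
  have : MeasurableSet {s : ℝ | x + s • e ∈ A} :=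
    (show Measurable fun s : ℝ => x + s • e by fun_prop) hA
  rw [lineLength, ← lintegral_indicator_one this]
  rfl

theorem measure_steiner {e : E} (he : ‖e‖ = 1) {R : ℝ} (hR : 0 ≤ R) {A : Set E}
    (hA : MeasurableSet A) (hAR : A ⊆ Metric.ball 0 R) : μ (steiner e A) = μ A := by
  rw [← lintegral_slab_mul_lineLength he hA,
    ← lintegral_slab_mul_lineLength he (measurableSet_steiner e hA)]
  refine lintegral_congr fun x => ?_
  rw [lineLength_steiner he (lineLength_ne_top he hR hAR x)]

end Steiner

section SteinerRiesz

variable {E : Type*} [NormedAddCommGroup E] [InnerProductSpace ℝ E] [FiniteDimensional ℝ E]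
  [MeasureSpace E] [BorelSpace E] [SFinite (volume : Measure E)]
  [(volume : Measure E).IsAddLeftInvariant]

theorem rieszInt_eq_lintegral_slab {e : E} (he : ‖e‖ = 1) {A B C : Set E} (hA : MeasurableSet A)
    (hB : MeasurableSet B) (hC : MeasurableSet C) :
    rieszInt A B C = ∫⁻ x : E, slab e x * ∫⁻ y : E, slab e y *
      rieszInt {s : ℝ | y + s • e ∈ A} {s : ℝ | x - y + s • e ∈ B} {s : ℝ | x + s • e ∈ C} := by
  have hmA : Measurable (A.indicator (1 : E → ℝ≥0∞)) := measurable_one.indicator hA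
  have hmC : Measurable (C.indicator (1 : E → ℝ≥0∞)) := measurable_one.indicator hC
  have hmB' : Measurable (B.indicator (1 : E → ℝ≥0∞)) := measurable_one.indicator hB
  have hmB := measurable_indicator_sub hB
  have hs := measurable_slab e
  set Φ : E → E → ℝ≥0∞ := fun x y => C.indicator 1 x * (A.indicator 1 y * B.indicator 1 (x - y))
  have hΦ : Measurable fun p : E × E => Φ p.1 p.2 := by fun_prop
  have hΦ' : Measurable fun x => ∫⁻ y, Φ x y := hΦ.lintegral_prod_right'
  have key (x y : E) (s t : ℝ) : Φ (x + s • e) (y + t • e) =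
      {s : ℝ | x + s • e ∈ C}.indicator 1 s * ({s : ℝ | y + s • e ∈ A}.indicator 1 t *
        {s : ℝ | x - y + s • e ∈ B}.indicator 1 (s - t)) := by
    have : x + s • e - (y + t • e) = x - y + (s - t) • e := by rw [sub_smul]; abel
    simp only [Φ, this]
    rfl
  calc rieszInt A B C = ∫⁻ x, ∫⁻ y, Φ x y := rfl
    _ = ∫⁻ x : E, slab e x * ∫⁻ s : ℝ, ∫⁻ y, Φ (x + s • e) y :=
        (lintegral_slab_mul he hΦ').symm
    _ = ∫⁻ x : E, slab e x * ∫⁻ s : ℝ, ∫⁻ y, slab e y * ∫⁻ t : ℝ, Φ (x + s • e) (y + t • e) := by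
        refine lintegral_congr fun x => ?_
        congr 1
        refine lintegral_congr fun s => ?_
        exact (lintegral_slab_mul he (hΦ.comp measurable_prodMk_left)).symm
    _ = _ := by
        refine lintegral_congr fun x => ?_
        congr 1
        have m (x : E) : Measurable fun p : (ℝ × E) × ℝ => Φ (x + p.1.1 • e) (p.1.2 + p.2 • e) := by
          fun_prop
        have m' : Measurable fun p : ℝ × E => ∫⁻ t : ℝ, Φ (x + p.1 • e) (p.2 + t • e) :=
          (m x).lintegral_prod_right'
        rw [lintegral_lintegral_swap (by fun_prop)]
        refine lintegral_congr fun y => ?_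
        have m'' : Measurable fun s : ℝ => ∫⁻ t : ℝ, Φ (x + s • e) (y + t • e) :=
          m'.comp (measurable_id.prodMk measurable_const)
        rw [lintegral_const_mul _ m'']
        simp only [rieszInt, key]

theorem rieszInt_le_rieszInt_steiner {e : E} (he : ‖e‖ = 1) {R : ℝ} (hR : 0 ≤ R) {A B C : Set E}
    (hA : MeasurableSet A) (hB : MeasurableSet B) (hC : MeasurableSet C)
    (hAR : A ⊆ Metric.ball 0 R) (hBR : B ⊆ Metric.ball 0 R) (hCR : C ⊆ Metric.ball 0 R) :
    rieszInt A B C ≤ rieszInt (steiner e A) (steiner e B) (steiner e C) := by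
  rw [rieszInt_eq_lintegral_slab he hA hB hC, rieszInt_eq_lintegral_slab he
    (measurableSet_steiner e hA) (measurableSet_steiner e hB) (measurableSet_steiner e hC)]
  gcongr with x y
  have hfA := lineLength_ne_top he hR hAR y
  have hfB := lineLength_ne_top he hR hBR (x - y)
  have hfC := lineLength_ne_top he hR hCR x
  have hm {S : Set E} (hS : MeasurableSet S) (z : E) : MeasurableSet {s : ℝ | z + s • e ∈ S} :=
    (show Measurable fun s : ℝ => z + s • e by fun_prop) hS
  rw [setOf_add_smul_mem_steiner he hfA, setOf_add_smul_mem_steiner he hfB,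
    setOf_add_smul_mem_steiner he hfC]
  have : (inner ℝ x e : ℝ) = inner ℝ y e + inner ℝ (x - y) e := by
    rw [← inner_add_left]; congr 1; abel
  rw [this, rieszInt_preimage_add_right]
  exact rieszInt_le_rieszInt_ball (hm hA y) (hm hB _) (hm hC x) hfA hfB hfC

end SteinerRiesz

section Symmetrization

variable {E : Type*} [NormedAddCommGroup E] [InnerProductSpace ℝ E]

theorem lineLength_steiner_diff_ball_le {e : E} (he : ‖e‖ = 1) {A : Set E} {x : E}
    (h : lineLength e A x ≠ ∞) {a : ℝ} (ha : 0 ≤ a) :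
    lineLength e (steiner e A \ Metric.ball 0 a) x ≤
      lineLength e A x - lineLength e (Metric.ball 0 a) x := by
  have h1 : {s : ℝ | x + s • e ∈ steiner e A \ Metric.ball 0 a} =
      {s : ℝ | x + s • e ∈ steiner e A} \ {s : ℝ | x + s • e ∈ Metric.ball 0 a} := rfl
  rw [lineLength_ball he ha, lineLength, h1, setOf_add_smul_mem_steiner he h,
    setOf_add_smul_mem_ball he ha, ← preimage_sdiff, measure_preimage_add_right]
  set α := (lineLength e A x).toReal / 2 with hα
  set β := √(a ^ 2 - ‖x‖ ^ 2 + inner ℝ x e ^ 2)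
  rcases le_total α β with hle | hle
  · rw [sdiff_eq_empty.2 (Metric.ball_subset_ball hle)]
    simp
  · rw [measure_sdiff (Metric.ball_subset_ball hle) Metric.isOpen_ball.nullMeasurableSet
      measure_ball_lt_top.ne, Real.volume_ball, Real.volume_ball, hα, mul_div_cancel₀ _ two_ne_zero,
      ofReal_toReal h]

variable [MeasurableSpace E] [BorelSpace E] [FiniteDimensional ℝ E]
  {μ : Measure E} [SFinite μ] [μ.IsAddLeftInvariant]

theorem measure_steiner_diff_ball_add_le {e : E} (he : ‖e‖ = 1) {R : ℝ} (hR : 0 ≤ R) {A : Set E}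
    (hA : MeasurableSet A) (hAR : A ⊆ Metric.ball 0 R) {a : ℝ} (ha : 0 ≤ a) (r : ℝ) :
    μ (steiner e A \ Metric.ball 0 a) +
      μ ((A \ Metric.ball 0 a) ∩ {x | x + r • e ∈ Metric.ball 0 a \ A}) ≤
      μ (A \ Metric.ball 0 a) := by
  set B : Set E := Metric.ball 0 a
  have hB : MeasurableSet B := Metric.isOpen_ball.measurableSet
  set N := (A \ B) ∩ {x | x + r • e ∈ B \ A}
  have hN : MeasurableSet N :=
    (hA.diff hB).inter ((measurable_id.add_const (r • e)) (hB.diff hA))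
  have hS := (measurableSet_steiner e hA).diff hB
  have hm {S : Set E} (hS : MeasurableSet S) (z : E) : MeasurableSet {s : ℝ | z + s • e ∈ S} :=
    (show Measurable fun s : ℝ => z + s • e by fun_prop) hS
  have hmS : Measurable fun x => slab e x * lineLength e (steiner e A \ B) x :=
    (measurable_slab e).mul (measurable_lineLength e hS)
  rw [← lintegral_slab_mul_lineLength he hS, ← lintegral_slab_mul_lineLength he hN,
    ← lintegral_slab_mul_lineLength he (hA.diff hB), ← lintegral_add_left hmS]
  refine lintegral_mono fun x => ?_
  simp only [← mul_add]
  gcongr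
  have hfA := lineLength_ne_top he hR hAR x
  have hfB : lineLength e B x ≠ ∞ := lineLength_ne_top he ha subset_rfl x
  have h1 : lineLength e A x - lineLength e B x =
      lineLength e (A \ B) x - lineLength e (B \ A) x := by
    have e1 : lineLength e A x = lineLength e (A ∩ B) x + lineLength e (A \ B) x :=
      (measure_inter_add_sdiff {s : ℝ | x + s • e ∈ A} (hm hB x)).symm
    have e2 : lineLength e B x = lineLength e (A ∩ B) x + lineLength e (B \ A) x := by
      rw [inter_comm]
      exact (measure_inter_add_sdiff {s : ℝ | x + s • e ∈ B} (hm hA x)).symm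
    have hf : lineLength e (A ∩ B) x ≠ ∞ :=
      ne_top_of_le_ne_top hfA (measure_mono fun _ h => h.1)
    rw [e1, e2, ENNReal.add_sub_add_eq_sub_left hf]
  have h2 : lineLength e N x ≤ min (lineLength e (A \ B) x) (lineLength e (B \ A) x) := by
    refine le_min (measure_mono fun _ h => h.1) ?_
    rw [← lineLength_add_smul e (B \ A) x r]
    refine measure_mono fun s h => ?_
    have := h.2
    simpa only [mem_ofPred_eq, add_right_comm] using this
  calc _ ≤ (lineLength e A x - lineLength e B x) +
        min (lineLength e (A \ B) x) (lineLength e (B \ A) x) :=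
        add_le_add (lineLength_steiner_diff_ball_le he hfA ha) h2
    _ = _ := by rw [h1, tsub_add_min]

theorem exists_lt_measure_inter_add {P Q : Set E} (hP : MeasurableSet P) (hQ : MeasurableSet Q)
    {R : ℝ} (hPR : P ⊆ Metric.ball 0 R) (hQR : Q ⊆ Metric.ball 0 R) {κ : ℝ≥0∞}
    (hκ : κ * μ (Metric.ball 0 (2 * R)) < μ P * μ Q) :
    ∃ v, κ < μ (P ∩ {x | x + v ∈ Q}) := by
  by_contra! hcon
  refine hκ.not_ge ?_
  have hmP : Measurable (P.indicator (1 : E → ℝ≥0∞)) := measurable_one.indicator hP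
  have hmQ : Measurable (Q.indicator (1 : E → ℝ≥0∞)) := measurable_one.indicator hQ
  have hS (v : E) : MeasurableSet (P ∩ {x | x + v ∈ Q}) :=
    hP.inter ((measurable_id.add_const v) hQ)
  have e1 (v : E) : μ (P ∩ {x | x + v ∈ Q}) = ∫⁻ x, P.indicator 1 x * Q.indicator 1 (x + v) ∂μ := by
    rw [← lintegral_indicator_one (hS v)]
    refine lintegral_congr fun x => ?_
    by_cases h1 : x ∈ P <;> by_cases h2 : x + v ∈ Q <;> simp [h1, h2, indicator]
  have e2 : ∫⁻ v, μ (P ∩ {x | x + v ∈ Q}) ∂μ = μ P * μ Q := by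
    simp_rw [e1]
    rw [lintegral_lintegral_swap (by fun_prop)]
    have (x : E) : ∫⁻ v, P.indicator (1 : E → ℝ≥0∞) x * Q.indicator 1 (x + v) ∂μ =
        P.indicator 1 x * μ Q := by
      rw [lintegral_const_mul _ (by fun_prop), lintegral_add_left_eq_self,
        lintegral_indicator_one hQ]
    simp_rw [this]
    rw [lintegral_mul_const _ hmP, lintegral_indicator_one hP]
  rw [← e2, ← setLIntegral_const]
  rw [← lintegral_indicator Metric.isOpen_ball.measurableSet]
  refine lintegral_mono fun v => ?_
  by_cases hv : v ∈ Metric.ball (0 : E) (2 * R)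
  · simpa [hv] using hcon v
  · have : P ∩ {x | x + v ∈ Q} = ∅ := by
      ext x
      simp only [mem_inter_iff, mem_ofPred_eq, mem_empty_iff_false, iff_false, not_and]
      intro hx hxv
      have h1 := mem_ball_zero_iff.1 (hPR hx)
      have h2 := mem_ball_zero_iff.1 (hQR hxv)
      have h3 : ‖v‖ ≤ ‖x + v‖ + ‖x‖ := by
        simpa using norm_sub_le (x + v) x
      exact hv (mem_ball_zero_iff.2 (by linarith))
    simp [this]

end Symmetrization

section Riesz

variable {E : Type*} [NormedAddCommGroup E] [InnerProductSpace ℝ E] [FiniteDimensional ℝ E]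
  [MeasureSpace E] [BorelSpace E] [(volume : Measure E).IsAddHaarMeasure]

/-- A set contained in a fixed ball and with measure equal to that of a centred ball, but far from
it, comes closer to that ball by a definite amount under some Steiner symmetrization. -/
theorem exists_steiner_diff_ball_add_le {R a : ℝ} (ha : 0 ≤ a) (haR : a ≤ R) {A : Set E}
    (hA : MeasurableSet A) (hAR : A ⊆ Metric.ball 0 R)
    (hvol : volume A = volume (Metric.ball (0 : E) a)) {κ : ℝ≥0∞}
    (hκ : κ * volume (Metric.ball (0 : E) (2 * R)) <
      volume (A \ Metric.ball 0 a) * volume (A \ Metric.ball 0 a)) :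
    ∃ e : E, ‖e‖ = 1 ∧
      volume (steiner e A \ Metric.ball 0 a) + κ ≤ volume (A \ Metric.ball 0 a) := by
  have hB : MeasurableSet (Metric.ball (0 : E) a) := Metric.isOpen_ball.measurableSet
  have hBR : Metric.ball (0 : E) a ⊆ Metric.ball 0 R := Metric.ball_subset_ball haR
  have hsymm : volume (A \ Metric.ball 0 a) = volume (Metric.ball 0 a \ A) := by
    have h1 := measure_inter_add_sdiff (μ := volume) A hB
    have h2 := measure_inter_add_sdiff (μ := volume) (Metric.ball 0 a) hA
    rw [← hvol, inter_comm, ← h1] at h2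
    have hf : volume (A ∩ Metric.ball 0 a) ≠ ∞ :=
      measure_ne_top_of_subset inter_subset_right measure_ball_lt_top.ne
    exact ((ENNReal.add_right_inj hf).1 h2).symm
  obtain ⟨v, hv⟩ := exists_lt_measure_inter_add (hA.diff hB) (hB.diff hA)
    (sdiff_subset.trans hAR) (sdiff_subset.trans hBR) (hκ.trans_eq (by rw [← hsymm]))
  have hv0 : v ≠ 0 := by
    rintro rfl
    have : (A \ Metric.ball 0 a) ∩ {x | x + 0 ∈ Metric.ball 0 a \ A} = ∅ := by
      ext x
      simp only [mem_inter_iff, Set.mem_sdiff, add_zero, mem_ofPred_eq, mem_empty_iff_false]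
      tauto
    rw [this] at hv
    simp at hv
  have hnv : ‖v‖ ≠ 0 := norm_ne_zero_iff.2 hv0
  have he : ‖‖v‖⁻¹ • v‖ = 1 := by
    rw [norm_smul, norm_inv, norm_norm, inv_mul_cancel₀ hnv]
  refine ⟨‖v‖⁻¹ • v, he, le_trans ?_
    (measure_steiner_diff_ball_add_le he (ha.trans haR) hA hAR ha ‖v‖)⟩
  rw [smul_inv_smul₀ hnv]
  gcongr

theorem exists_approx_ball {R : ℝ} (hR : 0 ≤ R) {ρ : Fin 3 → ℝ} (hρ : ∀ i, 0 ≤ ρ i)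
    (hρR : ∀ i, ρ i ≤ R) {A : Fin 3 → Set E} (hA : ∀ i, MeasurableSet (A i))
    (hAR : ∀ i, A i ⊆ Metric.ball 0 R)
    (hvol : ∀ i, volume (A i) = volume (Metric.ball (0 : E) (ρ i))) {ε : ℝ≥0∞} (hε : 0 < ε) :
    ∃ T : Fin 3 → Set E, (∀ i, MeasurableSet (T i)) ∧ (∀ i, T i ⊆ Metric.ball 0 R) ∧
      rieszInt (A 0) (A 1) (A 2) ≤ rieszInt (T 0) (T 1) (T 2) ∧
      ∑ i, volume (T i \ Metric.ball 0 (ρ i)) < ε := by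
  set S : Set (Fin 3 → Set E) := {T | (∀ i, MeasurableSet (T i)) ∧
    (∀ i, T i ⊆ Metric.ball 0 R) ∧ rieszInt (A 0) (A 1) (A 2) ≤ rieszInt (T 0) (T 1) (T 2) ∧
    ∀ i, volume (T i) = volume (Metric.ball (0 : E) (ρ i))}
  set d : (Fin 3 → Set E) → ℝ≥0∞ := fun T => ∑ i, volume (T i \ Metric.ball 0 (ρ i))
  have hAS : A ∈ S := ⟨hA, hAR, le_rfl, hvol⟩
  set δ := sInf (d '' S) with hδ
  suffices h0 : δ = 0 by
    obtain ⟨_, ⟨T, hT, rfl⟩, hlt⟩ := sInf_lt_iff.1 ((hδ.symm.trans h0).trans_lt hε)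
    exact ⟨T, hT.1, hT.2.1, hT.2.2.1, hlt⟩
  by_contra hne
  have hδtop : δ ≠ ∞ := by
    refine ne_top_of_le_ne_top (b := d A) ?_ (sInf_le ⟨A, hAS, rfl⟩)
    exact ENNReal.sum_ne_top.2 fun i _ =>
      measure_ne_top_of_subset (sdiff_subset.trans (hAR i)) measure_ball_lt_top.ne
  have h3 : δ / 3 * (δ / 3) ≠ 0 := by simp [hne]
  obtain ⟨κ, hκ0, hκ⟩ := ENNReal.exists_nnreal_pos_mul_lt
    (a := volume (Metric.ball (0 : E) (2 * R))) measure_ball_lt_top.ne h3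
  have hlt : δ < δ + κ := ENNReal.lt_add_right hδtop (by simpa using hκ0.ne')
  obtain ⟨_, ⟨T, hT, rfl⟩, hTlt⟩ := sInf_lt_iff.1 (hδ.symm.trans_lt hlt)
  obtain ⟨i, hi⟩ : ∃ i, δ / 3 ≤ volume (T i \ Metric.ball 0 (ρ i)) := by
    by_contra! hcon
    have h1 : d T < δ := by
      simp only [d, Fin.sum_univ_three]
      exact (ENNReal.add_lt_add (ENNReal.add_lt_add (hcon 0) (hcon 1)) (hcon 2)).trans_eq
        (ENNReal.add_thirds δ)
    exact h1.not_ge (sInf_le ⟨T, hT, rfl⟩)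
  obtain ⟨e, he, hstep⟩ := exists_steiner_diff_ball_add_le (hρ i) (hρR i) (hT.1 i) (hT.2.1 i)
    (hT.2.2.2 i) (κ := κ) (hκ.trans_le (by gcongr))
  set T' : Fin 3 → Set E := fun j => steiner e (T j)
  have hT' : T' ∈ S := by
    refine ⟨fun j => measurableSet_steiner e (hT.1 j), fun j => ?_, hT.2.2.1.trans ?_, fun j => ?_⟩
    · exact (steiner_mono e (hT.2.1 j)).trans (steiner_ball he hR).subset
    · exact rieszInt_le_rieszInt_steiner he hR (hT.1 0) (hT.1 1) (hT.1 2) (hT.2.1 0) (hT.2.1 1)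
        (hT.2.1 2)
    · rw [measure_steiner he hR (hT.1 j) (hT.2.1 j), hT.2.2.2 j]
  have hdec : d T' + κ ≤ d T := by
    calc d T' + κ
      _ = ∑ j, (volume (T' j \ Metric.ball 0 (ρ j)) + if j = i then (κ : ℝ≥0∞) else 0) := by
          rw [Finset.sum_add_distrib]
          simp [d]
      _ ≤ d T := by
          refine Finset.sum_le_sum fun j _ => ?_
          split_ifs with h
          · rw [h]; exact hstep
          · rw [add_zero]
            exact le_self_add.trans
              (measure_steiner_diff_ball_add_le he hR (hT.1 j) (hT.2.1 j) (hρ j) 0)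
  have : d T' < δ := lt_of_add_lt_add_right (hdec.trans_lt hTlt)
  exact this.not_ge (sInf_le ⟨T', hT', rfl⟩)

/-- The Riesz rearrangement inequality for three bounded sets. -/
theorem rieszInt_le_rieszInt_ball_of_subset_ball {R : ℝ} (hR : 0 ≤ R) {ρ : Fin 3 → ℝ}
    (hρ : ∀ i, 0 ≤ ρ i) (hρR : ∀ i, ρ i ≤ R) {A : Fin 3 → Set E} (hA : ∀ i, MeasurableSet (A i))
    (hAR : ∀ i, A i ⊆ Metric.ball 0 R)
    (hvol : ∀ i, volume (A i) = volume (Metric.ball (0 : E) (ρ i))) :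
    rieszInt (A 0) (A 1) (A 2) ≤
      rieszInt (Metric.ball 0 (ρ 0)) (Metric.ball 0 (ρ 1)) (Metric.ball (0 : E) (ρ 2)) := by
  set I := rieszInt (Metric.ball 0 (ρ 0)) (Metric.ball 0 (ρ 1)) (Metric.ball (0 : E) (ρ 2))
  set M := volume (Metric.ball (0 : E) R)
  have hB (i : Fin 3) : MeasurableSet (Metric.ball (0 : E) (ρ i)) :=
    Metric.isOpen_ball.measurableSet
  have key (ε : ℝ≥0∞) (hε : 0 < ε) : rieszInt (A 0) (A 1) (A 2) ≤ I + M * ε := by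
    obtain ⟨T, hT, hTR, hle, hlt⟩ := exists_approx_ball hR hρ hρR hA hAR hvol hε
    calc _ ≤ _ := hle
      _ ≤ I + volume (T 0 \ Metric.ball 0 (ρ 0)) * volume (T 1) +
          volume (T 0) * volume (T 1 \ Metric.ball 0 (ρ 1)) +
          volume (T 2 \ Metric.ball 0 (ρ 2)) * volume (T 0) :=
          rieszInt_le_add (hT 0) (hT 1) (hT 2) (hB 0) (hB 1) (hB 2)
      _ ≤ I + volume (T 0 \ Metric.ball 0 (ρ 0)) * M +
          M * volume (T 1 \ Metric.ball 0 (ρ 1)) +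
          volume (T 2 \ Metric.ball 0 (ρ 2)) * M := by
          gcongr
          · exact measure_mono (hTR 1)
          · exact measure_mono (hTR 0)
          · exact measure_mono (hTR 0)
      _ = I + M * ∑ i, volume (T i \ Metric.ball 0 (ρ i)) := by
          rw [Fin.sum_univ_three]
          ring
      _ ≤ _ := by gcongr
  have lim : Tendsto (fun ε : ℝ≥0∞ => I + M * ε) (nhdsWithin 0 (Ioi 0)) (nhds (I + M * 0)) := by
    refine (tendsto_const_nhds.add ?_).mono_left nhdsWithin_le_nhds
    exact ENNReal.Tendsto.const_mul tendsto_id (Or.inr measure_ball_lt_top.ne)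
  have := ge_of_tendsto lim (b := rieszInt (A 0) (A 1) (A 2)) (by
    filter_upwards [self_mem_nhdsWithin] with ε hε using key ε hε)
  simpa using this

end Riesz

section LayerCake

theorem setLIntegral_indicator_superlevel {α : Type*} (f : α → ℝ≥0∞) (x : α) :
    ∫⁻ t in Ioi (0 : ℝ), {y | ENNReal.ofReal t < f y}.indicator 1 x = f x := by
  have hm : MeasurableSet {s : ℝ | ENNReal.ofReal s < f x} :=
    measurableSet_lt ENNReal.measurable_ofReal measurable_const
  change ∫⁻ t in Ioi (0 : ℝ), {s : ℝ | ENNReal.ofReal s < f x}.indicator 1 t = f x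
  rw [lintegral_indicator_one hm, Measure.restrict_apply hm]
  generalize f x = a
  induction a with
  | top =>
    have : {s : ℝ | ENNReal.ofReal s < ∞} ∩ Ioi 0 = Ioi 0 := by ext; simp
    rw [this, Real.volume_Ioi]
  | coe a =>
    have : {s : ℝ | ENNReal.ofReal s < a} ∩ Ioi 0 = Ioo 0 (a : ℝ) := by
      ext s
      simp only [mem_inter_iff, mem_ofPred_eq, mem_Ioi, mem_Ioo]
      rw [and_comm]
      refine and_congr_right fun hs => ?_
      rw [ENNReal.ofReal_lt_iff_lt_toReal hs.le coe_ne_top, coe_toReal]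
    rw [this, Real.volume_Ioo, sub_zero, ofReal_coe_nnreal]


variable {α : Type*} [MeasurableSpace α]

theorem measurableSet_ofReal_lt {f : α → ℝ≥0∞} (hf : Measurable f) :
    MeasurableSet {p : ℝ × α | ENNReal.ofReal p.1 < f p.2} :=
  measurableSet_lt (by fun_prop) (by fun_prop)

theorem measurable_indicator_of_measurableSet {A : ℝ → Set α}
    (hA : MeasurableSet {p : ℝ × α | p.2 ∈ A p.1}) :
    Measurable fun p : ℝ × α => (A p.1).indicator (1 : α → ℝ≥0∞) p.2 :=
  (measurable_one (α := ℝ≥0∞)).indicator hA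

theorem measurableSet_of_measurableSet_prod {A : ℝ → Set α}
    (hA : MeasurableSet {p : ℝ × α | p.2 ∈ A p.1}) (t : ℝ) : MeasurableSet (A t) :=
  (measurable_const.prodMk measurable_id) hA

theorem lintegral_layer {ν : Measure α} [SFinite ν] {A : ℝ → Set α}
    (hA : MeasurableSet {p : ℝ × α | p.2 ∈ A p.1}) :
    ∫⁻ x, (∫⁻ t in Ioi (0 : ℝ), (A t).indicator 1 x) ∂ν = ∫⁻ t in Ioi (0 : ℝ), ν (A t) := by
  rw [lintegral_lintegral_swap
    (f := fun x t => (A t).indicator (1 : α → ℝ≥0∞) x)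
    ((measurable_indicator_of_measurableSet hA).comp measurable_swap).aemeasurable]
  refine lintegral_congr fun t => ?_
  exact lintegral_indicator_one (measurableSet_of_measurableSet_prod hA t)

/-- The layer cake formula for `ℝ≥0∞`-valued functions. -/
theorem lintegral_eq_lintegral_superlevel {ν : Measure α} [SFinite ν] {f : α → ℝ≥0∞}
    (hf : Measurable f) :
    ∫⁻ x, f x ∂ν = ∫⁻ t in Ioi (0 : ℝ), ν {x | ENNReal.ofReal t < f x} := by
  rw [← lintegral_layer (measurableSet_ofReal_lt hf)]
  simp_rw [setLIntegral_indicator_superlevel]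

theorem antitone_measure_superlevel (ν : Measure α) (f : α → ℝ≥0∞) :
    Antitone fun t : ℝ => ν {x | ENNReal.ofReal t < f x} :=
  fun _ _ h => measure_mono fun _ hx => (ENNReal.ofReal_le_ofReal h).trans_lt hx

theorem lintegral_lintegral_lintegral_rotate {μ ν : Measure α} {τ : Measure ℝ} [SFinite μ]
    [SFinite ν] [SFinite τ] {K : α → α → ℝ → ℝ≥0∞}
    (hK : Measurable fun p : α × α × ℝ => K p.1 p.2.1 p.2.2) :
    ∫⁻ x, (∫⁻ y, (∫⁻ t, K x y t ∂τ) ∂ν) ∂μ = ∫⁻ t, (∫⁻ x, (∫⁻ y, K x y t ∂ν) ∂μ) ∂τ := by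
  have e (x : α) : ∫⁻ y, (∫⁻ t, K x y t ∂τ) ∂ν = ∫⁻ t, (∫⁻ y, K x y t ∂ν) ∂τ :=
    lintegral_lintegral_swap (hK.comp (measurable_const.prodMk measurable_id)).aemeasurable
  simp_rw [e]
  refine lintegral_lintegral_swap (Measurable.aemeasurable ?_)
  have : Measurable fun q : (α × ℝ) × α => K q.1.1 q.2 q.1.2 :=
    hK.comp ((measurable_fst.comp measurable_fst).prodMk
      (measurable_snd.prodMk (measurable_snd.comp measurable_fst)))
  exact this.lintegral_prod_right'

/-- Two functions of a level parameter whose tails compare also compare after truncation. -/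
theorem lintegral_min_le_lintegral_min {a g : ℝ → ℝ≥0∞} (hg : Antitone g)
    (h : ∀ τ, 0 ≤ τ → ∫⁻ t in Ioi τ, a t ≤ ∫⁻ t in Ioi τ, g t) (d : ℝ≥0∞) :
    ∫⁻ t in Ioi (0 : ℝ), min d (a t) ≤ ∫⁻ t in Ioi (0 : ℝ), min d (g t) := by
  by_cases hT : ∃ t, 0 < t ∧ g t ≤ d
  · set T := {t | 0 < t ∧ g t ≤ d}
    have hbdd : BddBelow T := ⟨0, fun t ht => ht.1.le⟩
    have h0 : 0 ≤ sInf T := le_csInf hT fun t ht => ht.1.le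
    have hsplit (φ : ℝ → ℝ≥0∞) : ∫⁻ t in Ioi (0 : ℝ), φ t =
        (∫⁻ t in Ioo 0 (sInf T), φ t) + ∫⁻ t in Ioi (sInf T), φ t := by
      rw [← Ioc_union_Ioi_eq_Ioi h0, lintegral_union measurableSet_Ioi
        (Ioc_disjoint_Ioi le_rfl), restrict_Ioo_eq_restrict_Ioc]
    rw [hsplit, hsplit]
    refine add_le_add (setLIntegral_mono' measurableSet_Ioo fun t ht => ?_) ?_
    · have : d < g t := by
        by_contra! hle
        exact (csInf_le hbdd ⟨ht.1, hle⟩).not_gt ht.2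
      rw [min_eq_left this.le]
      exact min_le_left _ _
    · calc _ ≤ ∫⁻ t in Ioi (sInf T), a t := lintegral_mono fun t => min_le_right _ _
        _ ≤ _ := h _ h0
        _ ≤ _ := setLIntegral_mono' measurableSet_Ioi fun t ht => ?_
      obtain ⟨s, hs, hst⟩ := exists_lt_of_csInf_lt hT ht
      exact le_min ((hg hst.le).trans hs.2) le_rfl
  · push Not at hT
    refine setLIntegral_mono' measurableSet_Ioi fun t ht => ?_
    rw [min_eq_left (hT t ht).le]
    exact min_le_left _ _

end LayerCake

section RadiallyDecreasing

variable {E : Type*} [NormedAddCommGroup E]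

/-- A function that is a non-increasing function of the norm. -/
def RadiallyDecreasing (f : E → ℝ≥0∞) : Prop := ∀ ⦃x y⦄, ‖x‖ ≤ ‖y‖ → f y ≤ f x

/-- A set that contains with each point every point of at most the same norm. -/
def IsCentred (D : Set E) : Prop := ∀ ⦃x y⦄, ‖x‖ ≤ ‖y‖ → y ∈ D → x ∈ D

theorem IsCentred.measurableSet [MeasurableSpace E] [BorelSpace E] {D : Set E}
    (hD : IsCentred D) : MeasurableSet D := by
  have hS : IsLowerSet {r : ℝ | ∃ y ∈ D, r ≤ ‖y‖} := fun r s hsr ⟨y, hy, hr⟩ =>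
    ⟨y, hy, hsr.trans hr⟩
  have : D = norm ⁻¹' {r : ℝ | ∃ y ∈ D, r ≤ ‖y‖} :=
    ext fun x => ⟨fun hx => ⟨x, hx, le_rfl⟩, fun ⟨y, hy, h⟩ => hD h hy⟩
  rw [this]
  exact measurable_norm hS.ordConnected.measurableSet

theorem IsCentred.subset_or_subset {D D' : Set E} (hD : IsCentred D) (hD' : IsCentred D') :
    D ⊆ D' ∨ D' ⊆ D := by
  by_contra! h
  obtain ⟨⟨x, hx, hx'⟩, y, hy', hy⟩ := And.imp not_subset.1 not_subset.1 h
  rcases le_total ‖x‖ ‖y‖ with hxy | hxy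
  · exact hx' (hD' hxy hy')
  · exact hy (hD hxy hx)

theorem IsCentred.measure_inter [MeasurableSpace E] (μ : Measure E) {D D' : Set E}
    (hD : IsCentred D) (hD' : IsCentred D') : μ (D ∩ D') = min (μ D) (μ D') := by
  rcases hD.subset_or_subset hD' with h | h
  · rw [inter_eq_left.2 h, min_eq_left (measure_mono h)]
  · rw [inter_eq_right.2 h, min_eq_right (measure_mono h)]

theorem isCentred_ball (r : ℝ) : IsCentred (Metric.ball (0 : E) r) := fun _ _ h hy =>
  mem_ball_zero_iff.2 (h.trans_lt (mem_ball_zero_iff.1 hy))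

theorem RadiallyDecreasing.isCentred {f : E → ℝ≥0∞} (hf : RadiallyDecreasing f) (a : ℝ≥0∞) :
    IsCentred {x | a < f x} :=
  fun _ _ h hy => lt_of_lt_of_le hy (hf h)

theorem RadiallyDecreasing.measurable [MeasurableSpace E] [BorelSpace E] {f : E → ℝ≥0∞}
    (hf : RadiallyDecreasing f) : Measurable f :=
  measurable_of_Ioi fun a => (hf.isCentred a).measurableSet

theorem RadiallyDecreasing.eq_of_norm_eq {f : E → ℝ≥0∞} (hf : RadiallyDecreasing f) {x y : E}
    (h : ‖x‖ = ‖y‖) : f x = f y :=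
  le_antisymm (hf h.ge) (hf h.le)

theorem IsCentred.radiallyDecreasing_indicator {D : Set E} (hD : IsCentred D) :
    RadiallyDecreasing (D.indicator 1) := by
  intro x y h
  by_cases hy : y ∈ D
  · simp [hy, hD h hy]
  · simp [hy]

theorem RadiallyDecreasing.setLIntegral_eq [MeasurableSpace E] [BorelSpace E] {μ : Measure E}
    [SFinite μ] {f : E → ℝ≥0∞} (hf : RadiallyDecreasing f) {D : Set E} (hD : IsCentred D) :
    ∫⁻ x in D, f x ∂μ =
      ∫⁻ t in Ioi (0 : ℝ), min (μ D) (μ {x | ENNReal.ofReal t < f x}) := by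
  rw [lintegral_eq_lintegral_superlevel hf.measurable]
  refine lintegral_congr fun t => ?_
  rw [Measure.restrict_apply (hf.isCentred _).measurableSet, inter_comm,
    hD.measure_inter μ (hf.isCentred _)]

theorem RadiallyDecreasing.lintegral_mul_le [MeasurableSpace E] [BorelSpace E] {μ : Measure E}
    [SFinite μ] {φ ψ H : E → ℝ≥0∞} (hH : RadiallyDecreasing H) (hφ : Measurable φ)
    (hψ : Measurable ψ) (h : ∀ D, IsCentred D → ∫⁻ x in D, φ x ∂μ ≤ ∫⁻ x in D, ψ x ∂μ) :
    ∫⁻ x, φ x * H x ∂μ ≤ ∫⁻ x, ψ x * H x ∂μ := by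
  have key {φ : E → ℝ≥0∞} (hφ : Measurable φ) : ∫⁻ x, φ x * H x ∂μ =
      ∫⁻ t in Ioi (0 : ℝ), ∫⁻ x in {x | ENNReal.ofReal t < H x}, φ x ∂μ := by
    have := lintegral_withDensity_eq_lintegral_mul μ hφ hH.measurable
    simp only [Pi.mul_apply] at this
    rw [← this, lintegral_eq_lintegral_superlevel hH.measurable]
    refine lintegral_congr fun t => ?_
    rw [withDensity_apply _ (hH.isCentred _).measurableSet]
  rw [key hφ, key hψ]
  exact lintegral_mono fun t => h _ (hH.isCentred _)

end RadiallyDecreasing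

section Convolution

variable {n : ℕ} {f g : EuclideanSpace ℝ (Fin n) → ℝ≥0∞}

theorem norm_add_reflection_sub_sq {E : Type*} [NormedAddCommGroup E] [InnerProductSpace ℝ E]
    {u v : E} (huv : u ≠ v) (y : E) :
    ‖v + (ℝ ∙ (v - u))ᗮ.reflection (y - u)‖ ^ 2 - ‖y‖ ^ 2 =
      (‖y - v‖ ^ 2 - ‖y - u‖ ^ 2) / ‖v - u‖ ^ 2 * (‖v‖ ^ 2 - ‖u‖ ^ 2) := by
  have hw : ‖v - u‖ ≠ 0 := norm_ne_zero_iff.2 (sub_ne_zero.2 huv.symm)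
  have e1 : v + (ℝ ∙ (v - u))ᗮ.reflection (y - u) =
      y + (1 - 2 * (inner ℝ (v - u) (y - u) / ‖v - u‖ ^ 2)) • (v - u) := by
    rw [Submodule.reflection_orthogonal_apply, Submodule.reflection_singleton_apply]
    simp only [RCLike.ofReal_real_eq_id, id]
    module
  have e2 : ‖y - v‖ ^ 2 = ‖y - u‖ ^ 2 - 2 * inner ℝ (v - u) (y - u) + ‖v - u‖ ^ 2 := by
    rw [show y - v = (y - u) - (v - u) by abel, norm_sub_sq_real, real_inner_comm]
  have e3 : ‖v‖ ^ 2 = ‖u‖ ^ 2 + 2 * inner ℝ (v - u) u + ‖v - u‖ ^ 2 := by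
    conv_lhs => rw [show v = u + (v - u) by abel]
    rw [norm_add_sq_real, real_inner_comm]
  rw [e1, norm_add_sq_real, e2, e3, inner_smul_right, norm_smul, mul_pow, Real.norm_eq_abs, sq_abs,
    real_inner_comm (v - u) y, inner_sub_right (v - u) y u]
  field_simp
  ring

theorem RadiallyDecreasing.conv2 (hf : RadiallyDecreasing f) (hg : RadiallyDecreasing g) :
    RadiallyDecreasing (conv2 n f g) := by
  intro u v huv
  rcases eq_or_ne u v with rfl | hne
  · exact le_rfl
  set σ : EuclideanSpace ℝ (Fin n) → EuclideanSpace ℝ (Fin n) :=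
    fun y => v + (ℝ ∙ (v - u))ᗮ.reflection (y - u)
  have hσ : MeasurePreserving σ :=
    (measurePreserving_add_left volume v).comp
      ((LinearIsometryEquiv.measurePreserving _).comp (measurePreserving_sub_right volume u))
  have hmf := hf.measurable
  have hmg := hg.measurable
  have hsum {φ : EuclideanSpace ℝ (Fin n) → ℝ≥0∞} (hφ : Measurable φ) :
      ∫⁻ y, (φ y + φ (σ y)) = 2 * ∫⁻ y, φ y := by
    rw [lintegral_add_left hφ, hσ.lintegral_comp hφ, two_mul]
  have hσv (y) : ‖v - σ y‖ = ‖u - y‖ := by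
    simp only [σ, sub_add_cancel_left, norm_neg, LinearIsometryEquiv.norm_map]
    exact norm_sub_rev y u
  have hσu (y) : ‖u - σ y‖ = ‖v - y‖ := by
    have : u - σ y = (ℝ ∙ (v - u))ᗮ.reflection (v - y) := by
      have h := Submodule.reflection_orthogonalComplement_singleton_eq_neg (𝕜 := ℝ) (v - u)
      rw [show v - y = (v - u) - (y - u) by abel, map_sub, h]
      simp only [σ]
      abel
    rw [this, LinearIsometryEquiv.norm_map]
  have hsq : 0 ≤ ‖v‖ ^ 2 - ‖u‖ ^ 2 := by
    have := pow_le_pow_left₀ (norm_nonneg u) huv 2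
    linarith
  have rearr {a b c d : ℝ≥0∞} (h1 : b ≤ a) (h2 : d ≤ c) : a * d + b * c ≤ a * c + b * d := by
    obtain ⟨a', rfl⟩ := exists_add_of_le h1
    obtain ⟨c', rfl⟩ := exists_add_of_le h2
    calc _ ≤ (b + a') * d + b * (d + c') + a' * c' := le_self_add
      _ = _ := by ring
  have pt (y) : f y * g (v - y) + f (σ y) * g (v - σ y) ≤
      f y * g (u - y) + f (σ y) * g (u - σ y) := by
    rw [hg.eq_of_norm_eq (hσv y), hg.eq_of_norm_eq (hσu y)]
    have hnorm := norm_add_reflection_sub_sq hne y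
    rcases le_total ‖u - y‖ ‖v - y‖ with h | h
    · refine rearr (hf ?_) (hg h)
      have : 0 ≤ ‖y - v‖ ^ 2 - ‖y - u‖ ^ 2 := by
        rw [norm_sub_rev y v, norm_sub_rev y u]
        have := pow_le_pow_left₀ (norm_nonneg _) h 2
        linarith
      have h3 : 0 ≤ ‖σ y‖ ^ 2 - ‖y‖ ^ 2 := hnorm ▸ mul_nonneg (div_nonneg this (sq_nonneg _)) hsq
      exact le_of_sq_le_sq (sub_nonneg.1 h3) (norm_nonneg _)
    · rw [add_comm, add_comm (f y * _)]
      refine rearr (hf ?_) (hg h)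
      have : ‖y - v‖ ^ 2 - ‖y - u‖ ^ 2 ≤ 0 := by
        rw [norm_sub_rev y v, norm_sub_rev y u]
        have := pow_le_pow_left₀ (norm_nonneg _) h 2
        linarith
      have h3 : ‖σ y‖ ^ 2 - ‖y‖ ^ 2 ≤ 0 :=
        hnorm ▸ mul_nonpos_of_nonpos_of_nonneg (div_nonpos_of_nonpos_of_nonneg this (sq_nonneg _))
          hsq
      exact le_of_sq_le_sq (sub_nonpos.1 h3) (norm_nonneg _)
  have h2 : 2 * ∫⁻ y, f y * g (v - y) ≤ 2 * ∫⁻ y, f y * g (u - y) := by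
    rw [← hsum (by fun_prop), ← hsum (by fun_prop)]
    exact lintegral_mono pt
  exact (ENNReal.mul_le_mul_iff_right two_ne_zero ofNat_ne_top).1 h2

theorem measurable_conv2 (hf : Measurable f) (hg : Measurable g) : Measurable (conv2 n f g) := by
  have : Measurable fun p : EuclideanSpace ℝ (Fin n) × EuclideanSpace ℝ (Fin n) =>
    f p.2 * g (p.1 - p.2) := by fun_prop
  exact this.lintegral_prod_right'

theorem lintegral_conv2 (hf : Measurable f) (hg : Measurable g) :
    ∫⁻ x, conv2 n f g x = (∫⁻ x, f x) * ∫⁻ x, g x := by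
  simp only [conv2]
  rw [lintegral_lintegral_swap (by fun_prop)]
  have (y : EuclideanSpace ℝ (Fin n)) : ∫⁻ x, f y * g (x - y) = f y * ∫⁻ x, g x := by
    rw [lintegral_const_mul _ (by fun_prop), lintegral_sub_right_eq_self]
  simp_rw [this]
  rw [lintegral_mul_const _ hf]

/-- Duality for convolution with an even function. -/
theorem setLIntegral_conv2_eq (hf : Measurable f) (hg : Measurable g) (hfe : ∀ x, f (-x) = f x)
    {C : Set (EuclideanSpace ℝ (Fin n))} (hC : MeasurableSet C) :
    ∫⁻ x in C, conv2 n f g x = ∫⁻ y, g y * conv2 n (C.indicator 1) f y := by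
  have hmC : Measurable (C.indicator (1 : EuclideanSpace ℝ (Fin n) → ℝ≥0∞)) :=
    measurable_one.indicator hC
  have e1 (x) : conv2 n f g x = ∫⁻ y, f (x - y) * g y := by
    refine (lintegral_sub_left_eq_self (fun y => f y * g (x - y)) x).symm.trans ?_
    simp_rw [_root_.sub_sub_cancel]
  have e2 (y) : g y * conv2 n (C.indicator 1) f y = ∫⁻ x in C, f (x - y) * g y := by
    rw [conv2, ← lintegral_const_mul _ (by fun_prop), ← lintegral_indicator hC]
    refine lintegral_congr fun x => ?_
    by_cases h : x ∈ C
    · simp only [h, indicator_of_mem, Pi.one_apply, one_mul]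
      rw [← hfe, neg_sub, mul_comm]
    · simp [h]
  simp_rw [e1, e2]
  exact lintegral_lintegral_swap (by fun_prop)

/-- The convolution of two functions given by layers, integrated over a set. -/
theorem setLIntegral_conv2_layer {A B : ℝ → Set (EuclideanSpace ℝ (Fin n))}
    (hA : MeasurableSet {p : ℝ × EuclideanSpace ℝ (Fin n) | p.2 ∈ A p.1})
    (hB : MeasurableSet {p : ℝ × EuclideanSpace ℝ (Fin n) | p.2 ∈ B p.1})
    {C : Set (EuclideanSpace ℝ (Fin n))} (hC : MeasurableSet C) :
    ∫⁻ x in C, conv2 n (fun y => ∫⁻ t in Ioi (0 : ℝ), (A t).indicator 1 y)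
      (fun y => ∫⁻ t in Ioi (0 : ℝ), (B t).indicator 1 y) x =
      ∫⁻ t in Ioi (0 : ℝ), (∫⁻ s in Ioi (0 : ℝ), rieszInt (A t) (B s) C) := by
  have ha := measurable_indicator_of_measurableSet hA
  have hb := measurable_indicator_of_measurableSet hB
  have hmC : Measurable (C.indicator (1 : EuclideanSpace ℝ (Fin n) → ℝ≥0∞)) :=
    measurable_one.indicator hC
  have ha' (y) : Measurable fun t => (A t).indicator (1 : EuclideanSpace ℝ (Fin n) → ℝ≥0∞) y :=
    ha.comp (measurable_id.prodMk measurable_const)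
  have hb' (y) : Measurable fun t => (B t).indicator (1 : EuclideanSpace ℝ (Fin n) → ℝ≥0∞) y :=
    hb.comp (measurable_id.prodMk measurable_const)
  have hg : Measurable fun y =>
      ∫⁻ t in Ioi (0 : ℝ), (B t).indicator (1 : EuclideanSpace ℝ (Fin n) → ℝ≥0∞) y :=
    (hb.comp measurable_swap).lintegral_prod_right'
  have e1 (x) : C.indicator (conv2 n (fun y => ∫⁻ t in Ioi (0 : ℝ), (A t).indicator 1 y)
      (fun y => ∫⁻ t in Ioi (0 : ℝ), (B t).indicator 1 y)) x =
      ∫⁻ y, (∫⁻ t in Ioi (0 : ℝ), C.indicator 1 x * ((A t).indicator 1 y *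
        ∫⁻ s in Ioi (0 : ℝ), (B s).indicator 1 (x - y))) := by
    by_cases h : x ∈ C
    · simp only [h, indicator_of_mem, Pi.one_apply, one_mul, conv2]
      refine lintegral_congr fun y => ?_
      rw [lintegral_mul_const _ (ha' y)]
    · simp [h]
  rw [← lintegral_indicator hC]
  simp_rw [e1]
  rw [lintegral_lintegral_lintegral_rotate (by
    have h1 : Measurable fun p : EuclideanSpace ℝ (Fin n) × EuclideanSpace ℝ (Fin n) × ℝ =>
      (A p.2.2).indicator (1 : EuclideanSpace ℝ (Fin n) → ℝ≥0∞) p.2.1 :=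
      ha.comp (measurable_swap.comp measurable_snd)
    have h2 : Measurable fun p : EuclideanSpace ℝ (Fin n) × EuclideanSpace ℝ (Fin n) × ℝ =>
      ∫⁻ s in Ioi (0 : ℝ), (B s).indicator (1 : EuclideanSpace ℝ (Fin n) → ℝ≥0∞) (p.1 - p.2.1) :=
      hg.comp (measurable_fst.sub (measurable_fst.comp measurable_snd))
    exact (hmC.comp measurable_fst).mul (h1.mul h2))]
  refine lintegral_congr fun t => ?_
  have e2 (x y) : C.indicator (1 : EuclideanSpace ℝ (Fin n) → ℝ≥0∞) x * ((A t).indicator 1 y *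
      ∫⁻ s in Ioi (0 : ℝ), (B s).indicator 1 (x - y)) =
      ∫⁻ s in Ioi (0 : ℝ), C.indicator 1 x * ((A t).indicator 1 y * (B s).indicator 1 (x - y)) := by
    rw [lintegral_const_mul _ ((hb' _).const_mul _), lintegral_const_mul _ (hb' _)]
  simp_rw [e2]
  rw [lintegral_lintegral_lintegral_rotate (by
    have h1 : Measurable ((A t).indicator (1 : EuclideanSpace ℝ (Fin n) → ℝ≥0∞)) :=
      measurable_one.indicator (measurableSet_of_measurableSet_prod hA t)
    have h2 : Measurable fun p : EuclideanSpace ℝ (Fin n) × EuclideanSpace ℝ (Fin n) × ℝ =>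
      (B p.2.2).indicator (1 : EuclideanSpace ℝ (Fin n) → ℝ≥0∞) (p.1 - p.2.1) :=
      hb.comp ((measurable_snd.comp measurable_snd).prodMk
        (measurable_fst.sub (measurable_fst.comp measurable_snd)))
    exact (hmC.comp measurable_fst).mul ((h1.comp (measurable_fst.comp measurable_snd)).mul h2))]
  rfl

end Convolution

section Rearrangement

variable {n : ℕ}

theorem exists_ball_eq_ballRearrange {A : Set (EuclideanSpace ℝ (Fin n))} (hA : volume A ≠ ∞) :
    ∃ ρ : ℝ, 0 ≤ ρ ∧ volume (Metric.ball (0 : EuclideanSpace ℝ (Fin n)) ρ) = volume A ∧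
      ballRearrange n A = Metric.ball 0 ρ := by
  rcases Nat.eq_zero_or_pos n with rfl | hn
  · have hz (x : EuclideanSpace ℝ (Fin 0)) : ‖x‖ = 0 := by rw [Subsingleton.elim x 0, norm_zero]
    rcases eq_or_ne (volume A) 0 with h0 | h0
    · refine ⟨0, le_rfl, by simp [h0], ?_⟩
      ext x
      simp [ballRearrange, h0]
    · have hu : A = univ := Subsingleton.eq_univ_of_nonempty (nonempty_of_measure_ne_zero h0)
      have hb : Metric.ball (0 : EuclideanSpace ℝ (Fin 0)) 1 = univ :=
        Subsingleton.eq_univ_of_nonempty ⟨0, by simp⟩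
      refine ⟨1, zero_le_one, by rw [hb, hu], ?_⟩
      rw [hb]
      ext x
      simp [ballRearrange, hz, pos_iff_ne_zero.2 h0]
  · have : Nonempty (Fin n) := ⟨⟨0, hn⟩⟩
    set ω := volume (Metric.ball (0 : EuclideanSpace ℝ (Fin n)) 1)
    have hω0 : ω ≠ 0 := (Metric.measure_ball_pos _ _ one_pos).ne'
    have hω : ω ≠ ∞ := measure_ball_lt_top.ne
    have hvol {r : ℝ} (hr : 0 ≤ r) :
        volume (Metric.ball (0 : EuclideanSpace ℝ (Fin n)) r) = ENNReal.ofReal (r ^ n) * ω := by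
      rw [Measure.addHaar_ball _ _ hr, finrank_euclideanSpace_fin]
    have hq0 : 0 ≤ (volume A / ω).toReal := toReal_nonneg
    set ρ := (volume A / ω).toReal ^ ((n : ℝ)⁻¹)
    have hρ : 0 ≤ ρ := Real.rpow_nonneg hq0 _
    have hball : volume (Metric.ball (0 : EuclideanSpace ℝ (Fin n)) ρ) = volume A := by
      rw [hvol hρ, Real.rpow_inv_natCast_pow hq0 hn.ne', ofReal_toReal (div_ne_top hA hω0),
        ENNReal.div_mul_cancel hω0 hω]
    refine ⟨ρ, hρ, hball, ?_⟩
    ext x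
    rw [mem_ball_zero_iff, ballRearrange, mem_ofPred_eq, ← hball, hvol hρ, hvol (norm_nonneg x),
      ENNReal.mul_lt_mul_iff_left hω0 hω,
      ENNReal.ofReal_lt_ofReal_iff_of_nonneg (by positivity),
      pow_lt_pow_iff_left₀ (norm_nonneg x) hρ hn.ne']

theorem ballRearrange_mono {A B : Set (EuclideanSpace ℝ (Fin n))} (h : volume A ≤ volume B) :
    ballRearrange n A ⊆ ballRearrange n B :=
  fun _ hx => lt_of_lt_of_le hx h

theorem isCentred_ballRearrange (A : Set (EuclideanSpace ℝ (Fin n))) :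
    IsCentred (ballRearrange n A) :=
  fun _ _ h hy => (measure_mono (Metric.ball_subset_ball h)).trans_lt hy

theorem measure_ballRearrange (A : Set (EuclideanSpace ℝ (Fin n))) :
    volume (ballRearrange n A) = volume A := by
  by_cases hA : volume A = ∞
  · have : ballRearrange n A = univ := eq_univ_of_forall fun x => by
      simp only [ballRearrange, mem_ofPred_eq, hA]
      exact measure_ball_lt_top
    rw [this, hA]
    exact top_le_iff.1 (hA ▸ measure_mono (subset_univ A))
  · obtain ⟨ρ, -, h1, h2⟩ := exists_ball_eq_ballRearrange hA
    rw [h2, h1]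

/-- The Riesz rearrangement inequality for sets. -/
theorem rieszInt_le_rieszInt_ballRearrange {A B C : Set (EuclideanSpace ℝ (Fin n))}
    (hA : MeasurableSet A) (hB : MeasurableSet B) (hC : MeasurableSet C) :
    rieszInt A B C ≤ rieszInt (ballRearrange n A) (ballRearrange n B) (ballRearrange n C) := by
  set S : Fin 3 → Set (EuclideanSpace ℝ (Fin n)) := ![A, B, C]
  have hS (i) : MeasurableSet (S i) := by fin_cases i <;> assumption
  have bounded (k : ℕ) : rieszInt (A ∩ Metric.ball 0 k) (B ∩ Metric.ball 0 k)
      (C ∩ Metric.ball 0 k) ≤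
      rieszInt (ballRearrange n A) (ballRearrange n B) (ballRearrange n C) := by
    have hfin (i) : volume (S i ∩ Metric.ball 0 k) ≠ ∞ :=
      measure_ne_top_of_subset inter_subset_right measure_ball_lt_top.ne
    choose ρ hρ hvol heq using fun i => exists_ball_eq_ballRearrange (hfin i)
    have hR : (k : ℝ) ≤ k + ∑ i, ρ i := le_add_of_nonneg_right (Finset.sum_nonneg fun i _ => hρ i)
    refine (rieszInt_le_rieszInt_ball_of_subset_ball (R := k + ∑ i, ρ i)
      (A := fun i => S i ∩ Metric.ball 0 k) (k.cast_nonneg.trans hR) hρ (fun i => ?_)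
      (fun i => (hS i).inter Metric.isOpen_ball.measurableSet)
      (fun i => inter_subset_right.trans (Metric.ball_subset_ball hR))
      (fun i => (hvol i).symm)).trans ?_
    · exact (Finset.single_le_sum (fun i _ => hρ i) (Finset.mem_univ i)).trans
        (le_add_of_nonneg_left k.cast_nonneg)
    · rw [← heq, ← heq, ← heq]
      exact rieszInt_mono (ballRearrange_mono (measure_mono inter_subset_left))
        (ballRearrange_mono (measure_mono inter_subset_left))
        (ballRearrange_mono (measure_mono inter_subset_left))
  set W : ℕ → Set (EuclideanSpace ℝ (Fin n) × EuclideanSpace ℝ (Fin n)) := fun k =>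
    {p | p.1 ∈ C ∩ Metric.ball 0 k ∧ p.2 ∈ A ∩ Metric.ball 0 k ∧
      p.1 - p.2 ∈ B ∩ Metric.ball 0 k}
  have hprod {A B C : Set (EuclideanSpace ℝ (Fin n))} (hA : MeasurableSet A)
      (hB : MeasurableSet B) (hC : MeasurableSet C) : rieszInt A B C =
        volume {p : EuclideanSpace ℝ (Fin n) × EuclideanSpace ℝ (Fin n) |
          p.1 ∈ C ∧ p.2 ∈ A ∧ p.1 - p.2 ∈ B} := by
    have hm : MeasurableSet {p : EuclideanSpace ℝ (Fin n) × EuclideanSpace ℝ (Fin n) |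
        p.1 ∈ C ∧ p.2 ∈ A ∧ p.1 - p.2 ∈ B} :=
      (measurable_fst hC).inter ((measurable_snd hA).inter (measurable_sub hB))
    rw [rieszInt_eq_setLIntegral hA hB hC, Measure.volume_eq_prod, Measure.prod_apply hm,
      ← lintegral_indicator hC]
    refine lintegral_congr fun x => ?_
    by_cases h : x ∈ C
    · rw [indicator_of_mem h]
      congr 1
      ext y
      simp [h]
    · simp [h]
  have hmono : Monotone W := by
    intro k m hkm p hp
    have hb : Metric.ball (0 : EuclideanSpace ℝ (Fin n)) k ⊆ Metric.ball 0 m :=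
      Metric.ball_subset_ball (Nat.cast_le.2 hkm)
    exact ⟨⟨hp.1.1, hb hp.1.2⟩, ⟨hp.2.1.1, hb hp.2.1.2⟩, hp.2.2.1, hb hp.2.2.2⟩
  have hunion : {p : EuclideanSpace ℝ (Fin n) × EuclideanSpace ℝ (Fin n) |
      p.1 ∈ C ∧ p.2 ∈ A ∧ p.1 - p.2 ∈ B} = ⋃ k, W k := by
    ext p
    simp only [mem_iUnion]
    refine ⟨fun ⟨h1, h2, h3⟩ => ?_, fun ⟨k, h1, h2, h3⟩ => ⟨h1.1, h2.1, h3.1⟩⟩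
    obtain ⟨k, hk⟩ := exists_nat_gt (‖p.1‖ + ‖p.2‖)
    have := norm_nonneg p.1
    have := norm_nonneg p.2
    refine ⟨k, ⟨h1, ?_⟩, ⟨h2, ?_⟩, h3, ?_⟩ <;> rw [mem_ball_zero_iff]
    · linarith
    · linarith
    · linarith [norm_sub_le p.1 p.2]
  rw [hprod hA hB hC, hunion, hmono.measure_iUnion]
  refine iSup_le fun k => ?_
  have hb : MeasurableSet (Metric.ball (0 : EuclideanSpace ℝ (Fin n)) k) :=
    Metric.isOpen_ball.measurableSet
  exact (hprod (hA.inter hb) (hB.inter hb) (hC.inter hb)).symm.trans_le (bounded k)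

variable {f g : EuclideanSpace ℝ (Fin n) → ℝ≥0∞}

theorem radiallyDecreasing_symmRearr (f : EuclideanSpace ℝ (Fin n) → ℝ≥0∞) :
    RadiallyDecreasing (symmRearr n f) :=
  fun _ _ h => lintegral_mono fun _ =>
    (isCentred_ballRearrange _).radiallyDecreasing_indicator h

theorem measurableSet_ballRearrange_superlevel (f : EuclideanSpace ℝ (Fin n) → ℝ≥0∞) :
    MeasurableSet {p : ℝ × EuclideanSpace ℝ (Fin n) |
      p.2 ∈ ballRearrange n {x | ENNReal.ofReal p.1 < f x}} := by
  have h1 : Monotone fun r : ℝ => volume (Metric.ball (0 : EuclideanSpace ℝ (Fin n)) r) :=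
    fun _ _ h => measure_mono (Metric.ball_subset_ball h)
  exact measurableSet_lt (h1.measurable.comp (measurable_norm.comp measurable_snd))
    ((antitone_measure_superlevel volume f).measurable.comp measurable_fst)

theorem setLIntegral_symmRearr (f : EuclideanSpace ℝ (Fin n) → ℝ≥0∞)
    {D : Set (EuclideanSpace ℝ (Fin n))} (hD : IsCentred D) :
    ∫⁻ x in D, symmRearr n f x =
      ∫⁻ t in Ioi (0 : ℝ), min (volume D) (volume {x | ENNReal.ofReal t < f x}) := by
  simp only [symmRearr]
  rw [lintegral_layer (A := fun t => ballRearrange n {x | ENNReal.ofReal t < f x})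
    (measurableSet_ballRearrange_superlevel f)]
  refine lintegral_congr fun t => ?_
  rw [Measure.restrict_apply (isCentred_ballRearrange _).measurableSet, inter_comm,
    hD.measure_inter volume (isCentred_ballRearrange _), measure_ballRearrange]

/-- The Riesz rearrangement inequality for two functions and a set. -/
theorem setLIntegral_conv2_le (hf : Measurable f) (hg : Measurable g)
    {C : Set (EuclideanSpace ℝ (Fin n))} (hC : MeasurableSet C) :
    ∫⁻ x in C, conv2 n f g x ≤
      ∫⁻ x in ballRearrange n C, conv2 n (symmRearr n f) (symmRearr n g) x := by
  have h1 := setLIntegral_conv2_layer (A := fun t => {x | ENNReal.ofReal t < f x})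
    (B := fun t => {x | ENNReal.ofReal t < g x}) (measurableSet_ofReal_lt hf)
    (measurableSet_ofReal_lt hg) hC
  have h2 := setLIntegral_conv2_layer
    (A := fun t => ballRearrange n {x | ENNReal.ofReal t < f x})
    (B := fun t => ballRearrange n {x | ENNReal.ofReal t < g x})
    (measurableSet_ballRearrange_superlevel f) (measurableSet_ballRearrange_superlevel g)
    (isCentred_ballRearrange C).measurableSet
  simp only [setLIntegral_indicator_superlevel] at h1
  refine h1.trans_le (le_trans ?_ h2.ge)
  refine lintegral_mono fun t => lintegral_mono fun s => ?_
  exact rieszInt_le_rieszInt_ballRearrange (measurableSet_lt measurable_const hf)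
    (measurableSet_lt measurable_const hg) hC

/-- `∫ F ≤ ∫ G` over each measurable set and its rearrangement, respectively. -/
def DominatedByRearranged (F G : EuclideanSpace ℝ (Fin n) → ℝ≥0∞) : Prop :=
  ∀ C, MeasurableSet C → ∫⁻ x in C, F x ≤ ∫⁻ x in ballRearrange n C, G x

theorem DominatedByRearranged.lintegral_min_le {F G : EuclideanSpace ℝ (Fin n) → ℝ≥0∞}
    (h : DominatedByRearranged F G) (hF : Measurable F) (hFi : ∫⁻ x, F x ≠ ∞)
    (hG : RadiallyDecreasing G) (d : ℝ≥0∞) :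
    ∫⁻ t in Ioi (0 : ℝ), min d (volume {x | ENNReal.ofReal t < F x}) ≤
      ∫⁻ t in Ioi (0 : ℝ), min d (volume {x | ENNReal.ofReal t < G x}) := by
  refine lintegral_min_le_lintegral_min (antitone_measure_superlevel volume G) (fun τ hτ => ?_) d
  set C := {x | ENNReal.ofReal τ < F x} with hCdef
  have hC : MeasurableSet C := measurableSet_lt measurable_const hF
  have hsplit (φ : ℝ → ℝ≥0∞) : ∫⁻ t in Ioi (0 : ℝ), φ t =
      (∫⁻ t in Ioc 0 τ, φ t) + ∫⁻ t in Ioi τ, φ t := by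
    rw [← Ioc_union_Ioi_eq_Ioi hτ, lintegral_union measurableSet_Ioi (Ioc_disjoint_Ioi le_rfl)]
  have hfin : ∫⁻ _ in Ioc 0 τ, volume C ≠ ∞ := by
    rw [setLIntegral_const, Real.volume_Ioc, sub_zero, mul_comm]
    refine ne_top_of_le_ne_top hFi (le_trans ?_ (mul_meas_ge_le_lintegral hF (ENNReal.ofReal τ)))
    exact mul_le_mul_right (measure_mono fun x (hx : ENNReal.ofReal τ < F x) => hx.le) _
  have hle := h C hC
  rw [hG.setLIntegral_eq (isCentred_ballRearrange C), measure_ballRearrange,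
    lintegral_eq_lintegral_superlevel hF, hsplit, hsplit] at hle
  have e1 : ∫⁻ t in Ioc 0 τ, volume.restrict C {x | ENNReal.ofReal t < F x} =
      ∫⁻ _ in Ioc 0 τ, volume C := by
    refine setLIntegral_congr_fun measurableSet_Ioc fun t ht => ?_
    rw [Measure.restrict_apply (measurableSet_lt measurable_const hF), inter_eq_right.2]
    exact fun x hx => (ENNReal.ofReal_le_ofReal ht.2).trans_lt hx
  have e2 : ∫⁻ t in Ioi τ, volume.restrict C {x | ENNReal.ofReal t < F x} =
      ∫⁻ t in Ioi τ, volume {x | ENNReal.ofReal t < F x} := by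
    refine setLIntegral_congr_fun measurableSet_Ioi fun t ht => ?_
    rw [Measure.restrict_apply (measurableSet_lt measurable_const hF), inter_eq_left.2]
    exact fun x hx => (ENNReal.ofReal_le_ofReal (le_of_lt ht)).trans_lt hx
  rw [e1, e2] at hle
  refine (ENNReal.add_le_add_iff_left hfin).1 (hle.trans ?_)
  exact add_le_add (lintegral_mono fun t => min_le_left _ _)
    (lintegral_mono fun t => min_le_right _ _)

theorem dominatedByRearranged_symmRearr (hf : Measurable f) :
    DominatedByRearranged f (symmRearr n f) := by
  intro C hC
  rw [setLIntegral_symmRearr f (isCentred_ballRearrange C), measure_ballRearrange,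
    lintegral_eq_lintegral_superlevel hf]
  refine lintegral_mono fun t => le_min ?_ ?_
  · exact (measure_mono (subset_univ _)).trans_eq (Measure.restrict_apply_univ C)
  · exact Measure.restrict_apply_le C _

theorem DominatedByRearranged.conv2_symmRearr {F G : EuclideanSpace ℝ (Fin n) → ℝ≥0∞}
    (h : DominatedByRearranged F G) (hf : Measurable f) (hF : Measurable F)
    (hFi : ∫⁻ x, F x ≠ ∞) (hG : RadiallyDecreasing G) :
    DominatedByRearranged (conv2 n f F) (conv2 n (symmRearr n f) G) := by
  intro C hC
  have hf' := radiallyDecreasing_symmRearr f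
  have hF' := radiallyDecreasing_symmRearr F
  have hC' := isCentred_ballRearrange C
  have heven (x) : symmRearr n f (-x) = symmRearr n f x := hf'.eq_of_norm_eq (norm_neg x)
  refine (setLIntegral_conv2_le hf hF hC).trans ?_
  rw [setLIntegral_conv2_eq hf'.measurable hF'.measurable heven hC'.measurableSet,
    setLIntegral_conv2_eq hf'.measurable hG.measurable heven hC'.measurableSet]
  refine (hC'.radiallyDecreasing_indicator.conv2 hf').lintegral_mul_le hF'.measurable
    hG.measurable fun D hD => ?_
  rw [setLIntegral_symmRearr F hD, hG.setLIntegral_eq hD]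
  exact h.lintegral_min_le hF hFi hG _

theorem convList_dominatedByRearranged : ∀ l : List (EuclideanSpace ℝ (Fin n) → ℝ≥0∞), l ≠ [] →
    (∀ f ∈ l, IsDensity n f) →
    IsDensity n (convList n l) ∧ RadiallyDecreasing (convList n (l.map (symmRearr n))) ∧
      DominatedByRearranged (convList n l) (convList n (l.map (symmRearr n)))
  | [], h, _ => absurd rfl h
  | [f], _, hd => by
    have hf := hd f List.mem_cons_self
    exact ⟨hf, radiallyDecreasing_symmRearr f, dominatedByRearranged_symmRearr hf.1⟩
  | f :: g :: l, _, hd => by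
    have hf := hd f List.mem_cons_self
    obtain ⟨h1, h2, h3⟩ := convList_dominatedByRearranged (g :: l) (List.cons_ne_nil g l)
      fun φ hφ => hd φ (List.mem_cons_of_mem f hφ)
    refine ⟨⟨measurable_conv2 hf.1 h1.1, ?_⟩, (radiallyDecreasing_symmRearr f).conv2 h2,
      h3.conv2_symmRearr hf.1 h1.1 (h1.2.trans_ne one_ne_top) h2⟩
    exact (lintegral_conv2 hf.1 h1.1).trans (by rw [hf.2, h1.2, one_mul])

end Rearrangement

/-- The convolution of densities is majorized by the convolution of their
rearrangements: `f₁ ⋆ ⋯ ⋆ f_k ≺ f₁* ⋆ ⋯ ⋆ f_k*`. -/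
theorem convList_majorized (n : ℕ)
    (l : List (EuclideanSpace ℝ (Fin n) → ℝ≥0∞)) (hl : l ≠ [])
    (hd : ∀ f ∈ l, IsDensity n f) :
    Majorizes n (convList n l) (convList n (l.map (symmRearr n))) := by
  intro r _
  obtain ⟨hF, hG, h⟩ := convList_dominatedByRearranged l hl hd
  rw [setLIntegral_symmRearr _ (isCentred_ball r), setLIntegral_symmRearr _ (isCentred_ball r)]
  exact h.lintegral_min_le hF.1 (hF.2.trans_ne one_ne_top) hG _
end
end

section
/- (Hardy–Littlewood–Pólya–Chong majorization principle, continuous version) Let φ : [0,∞) → R be convex with φ(0) = 0 and continuous at 0. If probability densities f and g on R^n satisfy f ≺ g, then ∫ φ(f(x)) dx ≤ ∫ φ(g(x)) dx, provided both integrals are well defined. -/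
open MeasureTheory Set Filter ENNReal

noncomputable section

/-- `∫ φ(f)` is well defined. -/
def PhiDefined (n : ℕ) (φ : ℝ → ℝ) (f : EuclideanSpace ℝ (Fin n) → ℝ≥0∞) : Prop :=
  (∫⁻ x, ENNReal.ofReal (φ (f x).toReal)) ≠ ⊤ ∨
    (∫⁻ x, ENNReal.ofReal (-(φ (f x).toReal))) ≠ ⊤

/-- The value of `∫ φ(f)` as an extended real number. -/
def phiInt (n : ℕ) (φ : ℝ → ℝ) (f : EuclideanSpace ℝ (Fin n) → ℝ≥0∞) : EReal :=
  ((∫⁻ x, ENNReal.ofReal (φ (f x).toReal)) : EReal) -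
    ((∫⁻ x, ENNReal.ofReal (-(φ (f x).toReal))) : EReal)

section Distribution

variable {α : Type*} [MeasurableSpace α] {μ : Measure α}

/-- The distribution function of `f` is antitone. -/
theorem antitone_measure_ofReal_lt (f : α → ℝ≥0∞) :
    Antitone fun t : ℝ => μ {x | ENNReal.ofReal t < f x} := fun _ _ hst =>
  measure_mono fun _ hx => (ENNReal.ofReal_le_ofReal hst).trans_lt hx

/-- Above a nonnegative level, passing to real values does not change the distribution of an
a.e. finite function. -/
theorem measure_lt_toReal_eq {f : α → ℝ≥0∞} (hf : ∀ᵐ x ∂μ, f x ≠ ⊤) {t : ℝ} (ht : 0 ≤ t) :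
    μ {x | t < (f x).toReal} = μ {x | ENNReal.ofReal t < f x} := by
  refine measure_congr ?_
  filter_upwards [hf] with x hx
  exact propext (ENNReal.ofReal_lt_iff_lt_toReal ht hx).symm

theorem lintegral_eq_lintegral_measure_ofReal_lt {f : α → ℝ≥0∞} (hfm : Measurable f)
    (hf : ∀ᵐ x ∂μ, f x ≠ ⊤) :
    ∫⁻ x, f x ∂μ = ∫⁻ t in Ioi (0 : ℝ), μ {x | ENNReal.ofReal t < f x} := by
  calc
    ∫⁻ x, f x ∂μ = ∫⁻ x, ENNReal.ofReal (f x).toReal ∂μ := by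
      refine lintegral_congr_ae ?_
      filter_upwards [hf] with x hx
      rw [ENNReal.ofReal_toReal hx]
    _ = ∫⁻ t in Ioi (0 : ℝ), μ {x | t < (f x).toReal} :=
      lintegral_eq_lintegral_meas_lt μ (.of_forall fun _ => ENNReal.toReal_nonneg)
        hfm.ennreal_toReal.aemeasurable
    _ = _ := setLIntegral_congr_fun measurableSet_Ioi fun t ht =>
      measure_lt_toReal_eq hf (le_of_lt ht)

end Distribution

section Rearrangement

variable {n : ℕ}

theorem volume_ball_lt_volume_ball [NeZero n] {r s : ℝ} (hr : 0 ≤ r) (hrs : r < s) :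
    volume (Metric.ball (0 : EuclideanSpace ℝ (Fin n)) r) <
      volume (Metric.ball (0 : EuclideanSpace ℝ (Fin n)) s) := by
  rw [Measure.addHaar_ball _ _ hr, Measure.addHaar_ball _ _ (hr.trans hrs.le)]
  refine (ENNReal.mul_lt_mul_iff_left (Metric.measure_ball_pos _ _ one_pos).ne'
    measure_ball_lt_top.ne).2 ?_
  refine (ENNReal.ofReal_lt_ofReal_iff (pow_pos (hr.trans_lt hrs) _)).2 ?_
  exact pow_lt_pow_left₀ hrs hr (by simp [NeZero.ne n])

theorem volume_ball_mono :
    Monotone fun r : ℝ => volume (Metric.ball (0 : EuclideanSpace ℝ (Fin n)) r) :=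
  fun _ _ h => measure_mono (Metric.ball_subset_ball h)

theorem exists_volume_ball_eq [NeZero n] {m : ℝ≥0∞} (hm : m ≠ ⊤) :
    ∃ r : ℝ, 0 ≤ r ∧ volume (Metric.ball (0 : EuclideanSpace ℝ (Fin n)) r) = m := by
  set κ := volume (Metric.ball (0 : EuclideanSpace ℝ (Fin n)) 1)
  have hκ0 : κ ≠ 0 := (Metric.measure_ball_pos _ _ one_pos).ne'
  have hκt : κ ≠ ⊤ := measure_ball_lt_top.ne
  refine ⟨(m / κ).toReal ^ ((n : ℝ)⁻¹), by positivity, ?_⟩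
  rw [Measure.addHaar_ball _ _ (by positivity), finrank_euclideanSpace_fin,
    Real.rpow_inv_natCast_pow ENNReal.toReal_nonneg (NeZero.ne n),
    ENNReal.ofReal_toReal (ENNReal.div_ne_top hm hκ0), ENNReal.div_mul_cancel hκ0 hκt]

theorem ballRearrange_eq_ball [NeZero n] {A : Set (EuclideanSpace ℝ (Fin n))} {r : ℝ}
    (h : volume (Metric.ball (0 : EuclideanSpace ℝ (Fin n)) r) = volume A) :
    ballRearrange n A = Metric.ball 0 r := by
  ext x
  rw [mem_ball_zero_iff, ballRearrange, mem_ofPred_eq, ← h]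
  refine ⟨fun hx => lt_of_not_ge fun hle => hx.not_ge (volume_ball_mono hle),
    fun hx => volume_ball_lt_volume_ball (norm_nonneg x) hx⟩

theorem volume_ballRearrange_inter_ball [NeZero n] (A : Set (EuclideanSpace ℝ (Fin n))) (r : ℝ) :
    volume (ballRearrange n A ∩ Metric.ball 0 r) =
      min (volume A) (volume (Metric.ball (0 : EuclideanSpace ℝ (Fin n)) r)) := by
  by_cases hA : volume A = ⊤
  · have : ballRearrange n A = univ :=
      eq_univ_of_forall fun x => by
        rw [ballRearrange, mem_ofPred_eq, hA]
        exact measure_ball_lt_top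
    rw [this, hA, univ_inter, min_eq_right le_top]
  · obtain ⟨s, -, hsA⟩ := exists_volume_ball_eq (n := n) hA
    rw [ballRearrange_eq_ball hsA, ← hsA]
    rcases le_total s r with h | h
    · rw [inter_eq_left.2 (Metric.ball_subset_ball h), min_eq_left (volume_ball_mono h)]
    · rw [inter_eq_right.2 (Metric.ball_subset_ball h), min_eq_right (volume_ball_mono h)]

theorem setLIntegral_symmRearr_ball [NeZero n] (f : EuclideanSpace ℝ (Fin n) → ℝ≥0∞) (r : ℝ) :
    ∫⁻ x in Metric.ball (0 : EuclideanSpace ℝ (Fin n)) r, symmRearr n f x =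
      ∫⁻ t in Ioi (0 : ℝ), min (volume {x | ENNReal.ofReal t < f x})
        (volume (Metric.ball (0 : EuclideanSpace ℝ (Fin n)) r)) := by
  have hmeas : MeasurableSet {p : EuclideanSpace ℝ (Fin n) × ℝ |
      volume (Metric.ball (0 : EuclideanSpace ℝ (Fin n)) ‖p.1‖) <
        volume {x | ENNReal.ofReal p.2 < f x}} :=
    measurableSet_lt (volume_ball_mono.measurable.comp measurable_fst.norm)
      ((antitone_measure_ofReal_lt f).measurable.comp measurable_snd)
  unfold symmRearr
  rw [lintegral_lintegral_swap]
  · refine lintegral_congr fun t => ?_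
    rw [← volume_ballRearrange_inter_ball]
    have hB : MeasurableSet (ballRearrange n {x | ENNReal.ofReal t < f x}) :=
      measurable_prodMk_right (y := t) hmeas
    rw [lintegral_indicator_one hB, Measure.restrict_apply hB]
  · exact ((measurable_const (a := (1 : ℝ≥0∞))).indicator hmeas).aemeasurable

theorem Majorizes.setLIntegral_Ioi_le [NeZero n] {f g : EuclideanSpace ℝ (Fin n) → ℝ≥0∞}
    (hf : IsDensity n f) (hg : IsDensity n g) (h : Majorizes n f g) {a : ℝ} (ha : 0 ≤ a) :
    ∫⁻ t in Ioi a, volume {x | ENNReal.ofReal t < f x} ≤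
      ∫⁻ t in Ioi a, volume {x | ENNReal.ofReal t < g x} := by
  rcases ha.eq_or_lt with rfl | ha
  · have key : ∀ k, IsDensity n k →
        ∫⁻ t in Ioi (0 : ℝ), volume {x | ENNReal.ofReal t < k x} = 1 := fun k hk => by
      rw [← lintegral_eq_lintegral_measure_ofReal_lt hk.1
        ((ae_lt_top hk.1 (by simp [hk.2])).mono fun _ hx => hx.ne), hk.2]
    rw [key f hf, key g hg]
  set v := volume {x | ENNReal.ofReal a < f x} with hv
  have hvt : v ≠ ⊤ := by
    have hle : v ≤ volume {x | ENNReal.ofReal a ≤ f x} := by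
      refine measure_mono fun x hx => ?_
      rw [mem_ofPred_eq] at hx ⊢
      exact hx.le
    have hM := mul_meas_ge_le_lintegral (μ := volume) hf.1 (ENNReal.ofReal a)
    rw [hf.2] at hM
    refine ne_top_of_le_ne_top ?_ hle
    intro htop
    rw [htop, ENNReal.mul_top (by simpa using ha)] at hM
    exact absurd hM (by simp)
  obtain ⟨r, hr, hrv⟩ := exists_volume_ball_eq (n := n) hvt
  rcases hr.eq_or_lt with rfl | hr
  · have hv0 : v = 0 := by rw [← hrv]; simp
    have hle : ∫⁻ t in Ioi a, volume {x | ENNReal.ofReal t < f x} ≤ ∫⁻ _ in Ioi a, 0 := by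
      refine setLIntegral_mono measurable_const fun t ht => ?_
      rw [← hv0]
      exact antitone_measure_ofReal_lt f (le_of_lt ht)
    exact (hle.trans (by simp)).trans bot_le
  have hm := h r hr
  rw [setLIntegral_symmRearr_ball, setLIntegral_symmRearr_ball, hrv,
    ← Ioc_union_Ioi_eq_Ioi ha.le,
    lintegral_union measurableSet_Ioi (Ioc_disjoint_Ioi le_rfl),
    lintegral_union measurableSet_Ioi (Ioc_disjoint_Ioi le_rfl)] at hm
  have hf1 : ∫⁻ t in Ioc 0 a, min (volume {x | ENNReal.ofReal t < f x}) v =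
      ∫⁻ _ in Ioc 0 a, v :=
    setLIntegral_congr_fun measurableSet_Ioc fun t ht =>
      min_eq_right (antitone_measure_ofReal_lt f ht.2)
  have hf2 : ∫⁻ t in Ioi a, min (volume {x | ENNReal.ofReal t < f x}) v =
      ∫⁻ t in Ioi a, volume {x | ENNReal.ofReal t < f x} :=
    setLIntegral_congr_fun measurableSet_Ioi fun t ht =>
      min_eq_left (antitone_measure_ofReal_lt f (le_of_lt ht))
  have hg1 : ∫⁻ t in Ioc 0 a, min (volume {x | ENNReal.ofReal t < g x}) v ≤
      ∫⁻ _ in Ioc 0 a, v := lintegral_mono fun t => min_le_right _ _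
  have hg2 : ∫⁻ t in Ioi a, min (volume {x | ENNReal.ofReal t < g x}) v ≤
      ∫⁻ t in Ioi a, volume {x | ENNReal.ofReal t < g x} :=
    lintegral_mono fun t => min_le_left _ _
  rw [hf1, hf2] at hm
  have hc : ∫⁻ _ in Ioc 0 a, v ≠ ⊤ := by
    rw [setLIntegral_const]
    exact ENNReal.mul_ne_top hvt (by simp)
  exact (ENNReal.add_le_add_iff_left hc).1 (hm.trans (add_le_add hg1 hg2))

end Rearrangement

section Convex

/-- A nonnegative convex function on `[0,∞)` vanishing at `0` is the primitive of a nonnegative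
monotone function. -/
theorem ConvexOn.exists_monotone_eq_integral {ψ : ℝ → ℝ} (hψ : ConvexOn ℝ (Ici 0) ψ)
    (h0 : ψ 0 = 0) (hnn : ∀ u, 0 ≤ u → 0 ≤ ψ u) :
    ∃ d : ℝ → ℝ, Monotone d ∧ (∀ u, 0 ≤ d u) ∧ ∀ u, 0 ≤ u → ψ u = ∫ s in 0..u, d s := by
  have hmono : MonotoneOn ψ (Ici 0) := by
    intro x hx y hy hxy
    rcases (mem_Ici.1 hy).eq_or_lt with rfl | hy'
    · rw [le_antisymm hxy hx]
    have hc := hψ.2 (mem_Ici.2 le_rfl) hy (sub_nonneg.2 (div_le_one_of_le₀ hxy hy))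
      (div_nonneg hx hy) (sub_add_cancel 1 (x / y))
    simp only [smul_eq_mul, mul_zero, zero_add, h0, div_mul_cancel₀ x hy'.ne'] at hc
    exact hc.trans (mul_le_of_le_one_left (hnn y hy) (div_le_one_of_le₀ hxy hy))
  have himg : (fun u : ℝ => max u 0) '' univ = Ici 0 := by
    ext y
    refine ⟨?_, fun hy => ⟨y, mem_univ _, max_eq_left hy⟩⟩
    rintro ⟨x, -, rfl⟩
    exact le_max_right x 0
  have hconv : ConvexOn ℝ univ fun u => ψ (max u 0) := by
    have hmax : ConvexOn ℝ univ fun u : ℝ => max u 0 :=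
      (convexOn_id convex_univ).sup (convexOn_const 0 convex_univ)
    exact ConvexOn.comp (himg ▸ hψ) hmax (himg ▸ hmono)
  have hmonoE : Monotone fun u => ψ (max u 0) := fun x y hxy =>
    hmono (le_max_right x 0) (le_max_right y 0) (max_le_max_right 0 hxy)
  have hd : Monotone fun x => derivWithin (fun u => ψ (max u 0)) (Ioi x) x := by
    have := hconv.monotoneOn_rightDeriv
    rwa [interior_univ, monotoneOn_univ] at this
  refine ⟨_, hd, fun u => hmonoE.monotoneOn _ |>.derivWithin_nonneg, fun u hu => ?_⟩
  rw [intervalIntegral.integral_eq_sub_of_hasDeriv_right_of_le hu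
    (f := fun u => ψ (max u 0))
    ((hconv.continuousOn isOpen_univ).mono (subset_univ _))
    (fun x _ => hconv.hasDerivWithinAt_rightDeriv_of_mem_interior (by simp))
    hd.intervalIntegrable]
  simp [hu, h0]

/-- Integrals of monotone nonnegative functions over `(0,∞)` increase when the mass of every
half-line `(a,∞)` increases. -/
theorem Monotone.setLIntegral_mul_ofReal_le {p q : ℝ → ℝ≥0∞} (hp : Measurable p)
    (hq : Measurable q) (hpq : ∀ a, 0 ≤ a → ∫⁻ t in Ioi a, p t ≤ ∫⁻ t in Ioi a, q t)
    {d : ℝ → ℝ} (hd : Monotone d) (hd0 : ∀ u, 0 ≤ d u) :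
    ∫⁻ t in Ioi (0 : ℝ), p t * ENNReal.ofReal (d t) ≤
      ∫⁻ t in Ioi (0 : ℝ), q t * ENNReal.ofReal (d t) := by
  have key : ∀ p : ℝ → ℝ≥0∞, Measurable p → ∫⁻ t in Ioi (0 : ℝ), p t * ENNReal.ofReal (d t) =
      ∫⁻ s in Ioi (0 : ℝ), ∫⁻ t in {t | s < d t} ∩ Ioi 0, p t := by
    intro p hp
    have hL := lintegral_eq_lintegral_meas_lt ((volume.restrict (Ioi (0 : ℝ))).withDensity p)
      (.of_forall hd0) hd.measurable.aemeasurable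
    rw [lintegral_withDensity_eq_lintegral_mul _ hp hd.measurable.ennreal_ofReal] at hL
    simp only [Pi.mul_apply] at hL
    rw [hL]
    refine lintegral_congr fun s => ?_
    have hs : MeasurableSet {t | s < d t} := measurableSet_lt measurable_const hd.measurable
    rw [withDensity_apply _ hs, Measure.restrict_restrict hs]
  rw [key p hp, key q hq]
  refine lintegral_mono fun s => ?_
  rcases ({t | s < d t} ∩ Ioi (0 : ℝ)).eq_empty_or_nonempty with he | hne
  · simp [he]
  set S := {t | s < d t} ∩ Ioi (0 : ℝ)
  have hbdd : BddBelow S := ⟨0, fun t ht => le_of_lt ht.2⟩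
  have hnn : 0 ≤ sInf S := le_csInf hne fun t ht => le_of_lt ht.2
  have hS1 : Ioi (sInf S) ⊆ S := fun t ht => by
    obtain ⟨u, hu, hut⟩ := (csInf_lt_iff hbdd hne).1 ht
    exact ⟨lt_of_lt_of_le hu.1 (hd hut.le), hnn.trans_lt ht⟩
  have hS2 : S ⊆ Ici (sInf S) := fun t ht => csInf_le hbdd ht
  calc
    ∫⁻ t in S, p t ≤ ∫⁻ t in Ici (sInf S), p t := lintegral_mono_set hS2
    _ = ∫⁻ t in Ioi (sInf S), p t := setLIntegral_congr Ioi_ae_eq_Ici.symm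
    _ ≤ ∫⁻ t in Ioi (sInf S), q t := hpq _ hnn
    _ ≤ ∫⁻ t in S, q t := lintegral_mono_set hS1

theorem ConvexOn.lintegral_comp_toReal_le {α : Type*} [MeasurableSpace α] {μ : Measure α}
    {f g : α → ℝ≥0∞} (hfm : Measurable f) (hgm : Measurable g)
    (hf : ∀ᵐ x ∂μ, f x ≠ ⊤) (hg : ∀ᵐ x ∂μ, g x ≠ ⊤)
    (hfg : ∀ a : ℝ, 0 ≤ a → ∫⁻ t in Ioi a, μ {x | ENNReal.ofReal t < f x} ≤
      ∫⁻ t in Ioi a, μ {x | ENNReal.ofReal t < g x})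
    {ψ : ℝ → ℝ} (hψ : ConvexOn ℝ (Ici 0) ψ) (h0 : ψ 0 = 0) (hnn : ∀ u, 0 ≤ u → 0 ≤ ψ u) :
    ∫⁻ x, ENNReal.ofReal (ψ (f x).toReal) ∂μ ≤ ∫⁻ x, ENNReal.ofReal (ψ (g x).toReal) ∂μ := by
  obtain ⟨d, hd, hd0, hψd⟩ := hψ.exists_monotone_eq_integral h0 hnn
  have key : ∀ k : α → ℝ≥0∞, Measurable k → (∀ᵐ x ∂μ, k x ≠ ⊤) →
      ∫⁻ x, ENNReal.ofReal (ψ (k x).toReal) ∂μ =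
        ∫⁻ t in Ioi (0 : ℝ), μ {x | ENNReal.ofReal t < k x} * ENNReal.ofReal (d t) := by
    intro k hkm hk
    simp only [hψd _ ENNReal.toReal_nonneg]
    rw [lintegral_comp_eq_lintegral_meas_lt_mul μ (.of_forall fun _ => ENNReal.toReal_nonneg)
      hkm.ennreal_toReal.aemeasurable (fun t _ => hd.intervalIntegrable) (.of_forall hd0)]
    exact setLIntegral_congr_fun measurableSet_Ioi fun t ht => by
      simp only [measure_lt_toReal_eq hk (le_of_lt ht)]
  rw [key f hfm hf, key g hgm hg]
  exact Monotone.setLIntegral_mul_ofReal_le (antitone_measure_ofReal_lt f).measurable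
    (antitone_measure_ofReal_lt g).measurable hfg hd hd0

/-- The positive and negative parts of `u` in terms of `max (u + v) 0` for `v ≥ 0`. -/
theorem ofReal_add_ofReal_eq_max_add_min {u v : ℝ} (hv : 0 ≤ v) :
    ENNReal.ofReal u + ENNReal.ofReal v =
      ENNReal.ofReal (max (u + v) 0) + min (ENNReal.ofReal (-u)) (ENNReal.ofReal v) := by
  rcases le_total 0 u with hu | hu
  · rw [ENNReal.ofReal_of_nonpos (neg_nonpos.2 hu), min_eq_left (zero_le (a := ENNReal.ofReal v)), add_zero,
      max_eq_left (add_nonneg hu hv), ENNReal.ofReal_add hu hv]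
  · rw [ENNReal.ofReal_of_nonpos hu, zero_add, ← ENNReal.ofReal_min,
      ← ENNReal.ofReal_add (le_max_right _ _) (le_min (neg_nonneg.2 hu) hv)]
    congr 1
    rcases le_total (-u) v with h | h
    · rw [min_eq_left h, max_eq_left (by linarith)]; ring
    · rw [min_eq_right h, max_eq_right (by linarith)]; ring

/-- The majorization inequality with the negative parts moved to the opposite sides. -/
theorem ConvexOn.lintegral_pos_add_neg_le {α : Type*} [MeasurableSpace α] {μ : Measure α}
    {f g : α → ℝ≥0∞} (hfm : Measurable f) (hgm : Measurable g)
    (hfi : ∫⁻ x, f x ∂μ ≠ ⊤) (hfg_eq : ∫⁻ x, f x ∂μ = ∫⁻ x, g x ∂μ)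
    (hfg : ∀ a : ℝ, 0 ≤ a → ∫⁻ t in Ioi a, μ {x | ENNReal.ofReal t < f x} ≤
      ∫⁻ t in Ioi a, μ {x | ENNReal.ofReal t < g x})
    {φ : ℝ → ℝ} (hφ : ConvexOn ℝ (Ici 0) φ) (hφ0 : φ 0 = 0)
    (hφc : ContinuousWithinAt φ (Ici 0) 0) :
    ∫⁻ x, ENNReal.ofReal (φ (f x).toReal) ∂μ + ∫⁻ x, ENNReal.ofReal (-φ (g x).toReal) ∂μ ≤
      ∫⁻ x, ENNReal.ofReal (φ (g x).toReal) ∂μ +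
        ∫⁻ x, ENNReal.ofReal (-φ (f x).toReal) ∂μ := by
  have hcont : ContinuousOn φ (Ici 0) := by
    intro x hx
    rcases (mem_Ici.1 hx).eq_or_lt with rfl | hx'
    · exact hφc
    · have h := hφ.continuousOn_interior
      rw [interior_Ici] at h
      exact (h.continuousAt (Ioi_mem_nhds hx')).continuousWithinAt
  have hmeas : ∀ k : α → ℝ≥0∞, Measurable k → Measurable fun x => φ (k x).toReal := by
    intro k hk
    have h : Continuous fun u : ℝ => φ (max u 0) :=
      hcont.comp_continuous (by fun_prop) fun u => le_max_right u 0
    simpa [Function.comp_def] using h.measurable.comp hk.ennreal_toReal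
  have hft : ∀ᵐ x ∂μ, f x ≠ ⊤ := (ae_lt_top hfm hfi).mono fun _ hx => hx.ne
  have hgt : ∀ᵐ x ∂μ, g x ≠ ⊤ := (ae_lt_top hgm (hfg_eq ▸ hfi)).mono fun _ hx => hx.ne
  let N : (α → ℝ≥0∞) → ℕ → α → ℝ≥0∞ := fun k K x =>
    min (ENNReal.ofReal (-φ (k x).toReal)) (ENNReal.ofReal (K * (k x).toReal))
  have hNm : ∀ k, Measurable k → ∀ K, Measurable (N k K) := fun k hk K =>
    (hmeas k hk).neg.ennreal_ofReal.min (hk.ennreal_toReal.const_mul _).ennreal_ofReal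
  have hsplit : ∀ k, Measurable k → (∀ᵐ x ∂μ, k x ≠ ⊤) → ∀ K : ℕ,
      ∫⁻ x, ENNReal.ofReal (φ (k x).toReal) ∂μ + K * ∫⁻ x, k x ∂μ =
        ∫⁻ x, ENNReal.ofReal (max (φ (k x).toReal + K * (k x).toReal) 0) ∂μ +
          ∫⁻ x, N k K x ∂μ := by
    intro k hk hkt K
    rw [← lintegral_const_mul _ hk, ← lintegral_add_left (hmeas k hk).ennreal_ofReal,
      ← lintegral_add_right _ (hNm k hk K)]
    refine lintegral_congr_ae ?_
    filter_upwards [hkt] with x hx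
    rw [← ofReal_add_ofReal_eq_max_add_min (by positivity),
      ENNReal.ofReal_mul (Nat.cast_nonneg K), ENNReal.ofReal_toReal hx, ENNReal.ofReal_natCast]
  have htrunc : ∀ K : ℕ,
      ∫⁻ x, ENNReal.ofReal (φ (f x).toReal) ∂μ + ∫⁻ x, N g K x ∂μ ≤
        ∫⁻ x, ENNReal.ofReal (φ (g x).toReal) ∂μ +
          ∫⁻ x, ENNReal.ofReal (-φ (f x).toReal) ∂μ := by
    intro K
    have hψ : ConvexOn ℝ (Ici 0) fun u => max (φ u + K * u) 0 :=
      (hφ.add ((convexOn_id (convex_Ici 0)).smul (Nat.cast_nonneg K))).sup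
        (convexOn_const 0 (convex_Ici 0))
    have hle := hψ.lintegral_comp_toReal_le hfm hgm hft hgt hfg (by simp [hφ0])
      fun u _ => le_max_right _ _
    have hKt : (K : ℝ≥0∞) * ∫⁻ x, f x ∂μ ≠ ⊤ := ENNReal.mul_ne_top (by simp) hfi
    have hNf : ∫⁻ x, N f K x ∂μ ≤ ∫⁻ x, ENNReal.ofReal (-φ (f x).toReal) ∂μ :=
      lintegral_mono fun x => min_le_left _ _
    refine le_trans ?_ (add_le_add_right hNf _)
    refine (ENNReal.add_le_add_iff_right hKt).1 ?_
    calc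
      _ = ∫⁻ x, ENNReal.ofReal (φ (f x).toReal) ∂μ + K * ∫⁻ x, f x ∂μ +
          ∫⁻ x, N g K x ∂μ := by ring
      _ ≤ ∫⁻ x, ENNReal.ofReal (max (φ (g x).toReal + K * (g x).toReal) 0) ∂μ +
          ∫⁻ x, N f K x ∂μ + ∫⁻ x, N g K x ∂μ := by
        rw [hsplit f hfm hft K]
        gcongr
      _ = ∫⁻ x, ENNReal.ofReal (φ (g x).toReal) ∂μ + K * ∫⁻ x, g x ∂μ +
          ∫⁻ x, N f K x ∂μ := by
        rw [hsplit g hgm hgt K]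
        ring
      _ = _ := by
        rw [hfg_eq]
        ring
  have hsup : ∫⁻ x, ENNReal.ofReal (-φ (g x).toReal) ∂μ = ⨆ K : ℕ, ∫⁻ x, N g K x ∂μ := by
    rw [← lintegral_iSup (hNm g hgm)]
    · refine lintegral_congr fun x => le_antisymm ?_ (iSup_le fun K => min_le_left _ _)
      rcases (ENNReal.toReal_nonneg (a := g x)).eq_or_lt with h | h
      · simp [← h, hφ0]
      · obtain ⟨K, hK⟩ := exists_nat_ge (-φ (g x).toReal / (g x).toReal)
        refine le_iSup_of_le K (le_min le_rfl (ENNReal.ofReal_le_ofReal ?_))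
        exact (div_le_iff₀ h).1 hK
    · intro K L hKL x
      refine min_le_min_left _ (ENNReal.ofReal_le_ofReal ?_)
      gcongr
  rw [hsup, ENNReal.add_iSup]
  exact iSup_le htrunc

end Convex

theorem EReal.coe_sub_coe_le_of_add_le_add {a b c d : ℝ≥0∞} (hab : a ≠ ⊤ ∨ b ≠ ⊤)
    (hcd : c ≠ ⊤ ∨ d ≠ ⊤) (h : a + d ≤ c + b) : (a : EReal) - b ≤ (c : EReal) - d := by
  by_cases hb : b = ⊤
  · subst hb
    lift a to NNReal using by simpa using hab
    simp
  by_cases hc : c = ⊤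
  · subst hc
    lift d to NNReal using by simpa using hcd
    simp
  have had : a + d ≠ ⊤ := ne_top_of_le_ne_top (ENNReal.add_ne_top.2 ⟨hc, hb⟩) h
  lift a to NNReal using (ENNReal.add_ne_top.1 had).1
  lift d to NNReal using (ENNReal.add_ne_top.1 had).2
  lift b to NNReal using hb
  lift c to NNReal using hc
  have hadd : (a : ℝ) + d ≤ c + b := by exact_mod_cast h
  have hsub : (a : ℝ) - b ≤ c - d := by linarith
  simp only [EReal.coe_nnreal_eq_coe_real]
  exact_mod_cast hsub

/-- Two densities on the one-point space `ℝ⁰` agree. -/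
theorem IsDensity.eq_of_dim_zero {f g : EuclideanSpace ℝ (Fin 0) → ℝ≥0∞}
    (hf : IsDensity 0 f) (hg : IsDensity 0 g) : f = g := by
  have key : ∀ k : EuclideanSpace ℝ (Fin 0) → ℝ≥0∞, IsDensity 0 k →
      k 0 * volume (univ : Set (EuclideanSpace ℝ (Fin 0))) = 1 := fun k hk => by
    rw [← hk.2, ← lintegral_const]
    exact lintegral_congr fun x => congrArg k (Subsingleton.elim _ _)
  funext x
  rw [Subsingleton.elim x 0, ENNReal.eq_inv_of_mul_eq_one_left (key f hf),
    ENNReal.eq_inv_of_mul_eq_one_left (key g hg)]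

/-- Hardy–Littlewood–Pólya–Chong majorization principle: for convex
`φ : [0,∞) → ℝ` with `φ(0) = 0` continuous at `0`, if `f ≺ g` then
`∫ φ(f) ≤ ∫ φ(g)`, provided both integrals are well defined. -/
theorem phiInt_mono_of_majorizes (n : ℕ) (φ : ℝ → ℝ) (hφ : ConvexOn ℝ (Ici 0) φ)
    (hφ0 : φ 0 = 0) (hφc : ContinuousWithinAt φ (Ici 0) 0)
    (f g : EuclideanSpace ℝ (Fin n) → ℝ≥0∞)
    (hf : IsDensity n f) (hg : IsDensity n g) (hmaj : Majorizes n f g)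
    (hdf : PhiDefined n φ f) (hdg : PhiDefined n φ g) :
    phiInt n φ f ≤ phiInt n φ g := by
  rcases n.eq_zero_or_pos with rfl | hn
  · rw [hf.eq_of_dim_zero hg]
  have : NeZero n := ⟨hn.ne'⟩
  exact EReal.coe_sub_coe_le_of_add_le_add hdf hdg <|
    hφ.lintegral_pos_add_neg_le hf.1 hg.1 (by simp [hf.2]) (hf.2.trans hg.2.symm)
      (fun _ ha => hmaj.setLIntegral_Ioi_le hf hg ha) hφ0 hφc
end
end
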